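/- arXiv:1912.00204 — 5 statements merged into one kernel-verified Lean document; each statement's English description precedes it below -/
import Mathlib

section
/- Let l ≥ 1 and i be natural numbers with 0 ≤ i ≤ l, and let s ∈ [0,1] be a real number satisfying ∫₀^s dt/√(1 − t⁶) = (i/l)·∫₀¹ dt/√(1 − t⁶). Then s is algebraic over ℚ. Consequently, the points dividing the Kiepert curve {z ∈ ℂ : |z³ − 1| = 1} into parts of equal length starting from the origin have algebraic coordinates. -/
section ArcLength

open Set MeasureTheory intervalIntegral Filter Topology

/-- The arc length integral `∫₀ᵗ du/√(1 - u⁶)`. -/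
noncomputable def sexticArc (t : ℝ) : ℝ := ∫ u in (0:ℝ)..t, 1 / Real.sqrt (1 - u ^ 6)

lemma intervalIntegrable_one_div_sqrt_one_sub_pow_six :
    IntervalIntegrable (fun u : ℝ ↦ 1 / Real.sqrt (1 - u ^ 6)) volume 0 1 := by
  have h : IntervalIntegrable (fun u : ℝ ↦ (√(1 - u ^ 2))⁻¹) volume 0 1 := by
    rw [intervalIntegrable_iff_integrableOn_Ioc_of_le zero_le_one]
    refine integrableOn_deriv_of_nonneg Real.continuous_arcsin.continuousOn (fun x hx ↦ ?_)
      (by simp)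
    simpa using Real.hasDerivAt_arcsin (by linarith [hx.1]) (by linarith [hx.2])
  have hm : Measurable (fun u : ℝ ↦ 1 / Real.sqrt (1 - u ^ 6)) := by fun_prop
  refine h.mono_fun hm.aestronglyMeasurable ?_
  rw [uIoc_of_le zero_le_one, EventuallyLE, ae_restrict_iff' measurableSet_Ioc]
  have hne : ∀ᵐ u : ℝ, u ≠ 1 := by simp [ae_iff]
  filter_upwards [hne] with u hu1 hu
  have hlt : u < 1 := lt_of_le_of_ne hu.2 hu1
  have h2 : 0 < 1 - u ^ 2 := by nlinarith [hu.1]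
  have h6 : u ^ 6 ≤ u ^ 2 := pow_le_pow_of_le_one hu.1.le hu.2 (by norm_num)
  rw [one_div, Real.norm_of_nonneg (by positivity), Real.norm_of_nonneg (by positivity)]
  gcongr

lemma one_sub_pow_six_pos {t : ℝ} (ht : t ∈ Ioo (0:ℝ) 1) : 0 < 1 - t ^ 6 := by
  have := pow_lt_one₀ ht.1.le ht.2 (n := 6) (by norm_num)
  linarith

lemma hasDerivAt_sexticArc {t : ℝ} (ht : t ∈ Ioo (0:ℝ) 1) :
    HasDerivAt sexticArc (1 / Real.sqrt (1 - t ^ 6)) t := by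
  have hint : IntervalIntegrable (fun u : ℝ ↦ 1 / Real.sqrt (1 - u ^ 6)) volume 0 t :=
    intervalIntegrable_one_div_sqrt_one_sub_pow_six.mono_set
      (uIcc_subset_uIcc left_mem_uIcc (mem_uIcc_of_le ht.1.le ht.2.le))
  have hm : Measurable (fun u : ℝ ↦ 1 / Real.sqrt (1 - u ^ 6)) := by fun_prop
  refine integral_hasDerivAt_right hint
    hm.stronglyMeasurable.stronglyMeasurableAtFilter ?_
  have := (Real.sqrt_pos.mpr (one_sub_pow_six_pos ht)).ne'
  fun_prop (disch := assumption)

lemma continuousOn_sexticArc : ContinuousOn sexticArc (Icc 0 1) := by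
  have := continuousOn_primitive_interval' intervalIntegrable_one_div_sqrt_one_sub_pow_six
    (left_mem_uIcc (a := (0:ℝ)) (b := 1))
  rwa [uIcc_of_le zero_le_one] at this

lemma strictMonoOn_sexticArc : StrictMonoOn sexticArc (Icc 0 1) := by
  refine strictMonoOn_of_deriv_pos (convex_Icc 0 1) continuousOn_sexticArc fun x hx ↦ ?_
  rw [interior_Icc] at hx
  rw [(hasDerivAt_sexticArc hx).deriv]
  exact one_div_pos.mpr (Real.sqrt_pos.mpr (one_sub_pow_six_pos hx))

@[simp] lemma sexticArc_zero : sexticArc 0 = 0 := by simp [sexticArc]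

lemma image_sexticArc : sexticArc '' Icc 0 1 = Icc 0 (sexticArc 1) := by
  refine Subset.antisymm ?_ ?_
  · rintro _ ⟨t, ht, rfl⟩
    have hm := strictMonoOn_sexticArc.monotoneOn
    refine ⟨?_, hm ht (by simp) ht.2⟩
    simpa using hm (by simp) ht ht.1
  · simpa using intermediate_value_Icc zero_le_one continuousOn_sexticArc

/-- `S` behaves on `[0, ω]` like the solution of `S' = √(1 - S⁶)` rising from `0` to `1`. -/
structure IsSexticSine (S : ℝ → ℝ) (ω : ℝ) : Prop where
  continuous : Continuous S
  map_zero : S 0 = 0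
  map_right : S ω = 1
  mem_Ioo : ∀ z ∈ Ioo 0 ω, S z ∈ Ioo (0:ℝ) 1
  hasDerivAt : ∀ z ∈ Ioo 0 ω, HasDerivAt S (Real.sqrt (1 - S z ^ 6)) z

lemma exists_isSexticSine :
    ∃ S, IsSexticSine S (sexticArc 1) ∧ ∀ t ∈ Icc (0:ℝ) 1, S (sexticArc t) = t := by
  have hω : 0 ≤ sexticArc 1 := by
    simpa using (strictMonoOn_sexticArc (by simp) (by simp) (zero_lt_one' ℝ)).le
  let e := (strictMonoOn_sexticArc.orderIso sexticArc (Icc 0 1)).trans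
    (OrderIso.setCongr _ _ image_sexticArc)
  have he : ∀ t : Icc (0:ℝ) 1, (e t : ℝ) = sexticArc t := fun _ ↦ rfl
  let S : ℝ → ℝ := IccExtend hω fun z ↦ (e.symm z : ℝ)
  have hcont : Continuous S := (continuous_subtype_val.comp e.symm.continuous).Icc_extend'
  have hinv : ∀ t ∈ Icc (0:ℝ) 1, S (sexticArc t) = t := by
    intro t ht
    have hmem : sexticArc t ∈ Icc 0 (sexticArc 1) := image_sexticArc ▸ mem_image_of_mem _ ht
    have : (⟨sexticArc t, hmem⟩ : Icc 0 (sexticArc 1)) = e ⟨t, ht⟩ := Subtype.ext (he ⟨t, ht⟩).symm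
    simp only [S, IccExtend_of_mem hω _ hmem, this, e.symm_apply_apply]
  have hright : ∀ z ∈ Icc 0 (sexticArc 1), sexticArc (S z) = z := by
    intro z hz
    obtain ⟨t, ht, rfl⟩ := image_sexticArc ▸ hz
    rw [hinv t ht]
  have hmem : ∀ z ∈ Ioo 0 (sexticArc 1), S z ∈ Ioo (0:ℝ) 1 := by
    intro z hz
    obtain ⟨t, ht, rfl⟩ := image_sexticArc ▸ Ioo_subset_Icc_self hz
    rw [hinv t ht]
    refine ⟨lt_of_le_of_ne ht.1 ?_, lt_of_le_of_ne ht.2 ?_⟩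
    · rintro rfl; simp at hz
    · rintro rfl; simp at hz
  refine ⟨S, ⟨hcont, by simpa using hinv 0 (by simp), hinv 1 (by simp), hmem, fun z hz ↦ ?_⟩, hinv⟩
  have hpos := Real.sqrt_pos.mpr (one_sub_pow_six_pos (hmem z hz))
  have := HasDerivAt.of_local_left_inverse hcont.continuousAt
    (hasDerivAt_sexticArc (hmem z hz)) (one_div_pos.mpr hpos).ne'
    (by filter_upwards [Ioo_mem_nhds hz.1 hz.2] with y hy using hright y (Ioo_subset_Icc_self hy))
  simpa using this

end ArcLength

section AdditionFormula

open Set MeasureTheory intervalIntegral Filter Topology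

/-- Denominator of the addition formula for `S ^ 2`. -/
def addDen (a b : ℝ) : ℝ := 1 + 4 * a ^ 2 * b ^ 2 * (a ^ 2 + b ^ 2)

/-- Numerator of the addition formula for `S ^ 2`, with `p` and `q` the derivatives at `a`, `b`. -/
def addNum (a b p q : ℝ) : ℝ := a ^ 2 + b ^ 2 - 2 * a ^ 4 * b ^ 4 + 2 * a * b * p * q

/-- Numerator of the addition formula for `S * S'`. -/
def addNum' (a b p q : ℝ) : ℝ :=
  a * p * (1 - 4 * b ^ 6 - 12 * a ^ 2 * b ^ 4 - 4 * a ^ 4 * b ^ 2 - 8 * a ^ 4 * b ^ 8) +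
    b * q * (1 - 4 * a ^ 6 - 12 * a ^ 4 * b ^ 2 - 4 * a ^ 2 * b ^ 4 - 8 * a ^ 8 * b ^ 4)

lemma addDen_pos (a b : ℝ) : 0 < addDen a b := by unfold addDen; positivity

lemma hasDerivAt_addNum_div_addDen {A B P Q : ℝ → ℝ} {t : ℝ}
    (hA : HasDerivAt A (P t) t) (hB : HasDerivAt B (-Q t) t)
    (hP : HasDerivAt P (-3 * A t ^ 5) t) (hQ : HasDerivAt Q (3 * B t ^ 5) t)
    (hp : P t ^ 2 = 1 - A t ^ 6) (hq : Q t ^ 2 = 1 - B t ^ 6) :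
    HasDerivAt (fun t ↦ addNum (A t) (B t) (P t) (Q t) / addDen (A t) (B t)) 0 t := by
  have hD := (((hA.pow 2).const_mul 4).mul (hB.pow 2)).mul ((hA.pow 2).add (hB.pow 2))
    |>.const_add 1
  have hN := (((hA.pow 2).add (hB.pow 2)).sub (((hA.pow 4).const_mul 2).mul (hB.pow 4))).add
    ((((hA.const_mul 2).mul hB).mul hP).mul hQ)
  refine (hN.div hD (addDen_pos (A t) (B t)).ne').congr_deriv ?_
  rw [div_eq_zero_iff]
  left
  simp only [Pi.add_apply, Pi.mul_apply, Pi.pow_apply, Pi.sub_apply]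
  generalize A t = a at *
  generalize B t = b at *
  generalize P t = p at *
  generalize Q t = q at *
  push_cast
  linear_combination (2*b*q - 8*a^2*b^5*q - 24*a^4*b^3*q) * hp +
    (-2*a*p + 24*a^3*b^4*p + 8*a^5*b^2*p) * hq

lemma hasDerivAt_addNum'_div_addDen_sq {A B P Q : ℝ → ℝ} {t : ℝ}
    (hA : HasDerivAt A (P t) t) (hB : HasDerivAt B (-Q t) t)
    (hP : HasDerivAt P (-3 * A t ^ 5) t) (hQ : HasDerivAt Q (3 * B t ^ 5) t)
    (hp : P t ^ 2 = 1 - A t ^ 6) (hq : Q t ^ 2 = 1 - B t ^ 6) :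
    HasDerivAt (fun t ↦ addNum' (A t) (B t) (P t) (Q t) / addDen (A t) (B t) ^ 2) 0 t := by
  have hD := (((hA.pow 2).const_mul 4).mul (hB.pow 2)).mul ((hA.pow 2).add (hB.pow 2))
    |>.const_add 1
  have hM := ((hA.mul hP).mul ((((hB.pow 6).const_mul 4).const_sub 1).sub
      (((hA.pow 2).const_mul 12).mul (hB.pow 4)) |>.sub (((hA.pow 4).const_mul 4).mul (hB.pow 2))
      |>.sub (((hA.pow 4).const_mul 8).mul (hB.pow 8)))).add
    ((hB.mul hQ).mul ((((hA.pow 6).const_mul 4).const_sub 1).sub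
      (((hA.pow 4).const_mul 12).mul (hB.pow 2)) |>.sub (((hA.pow 2).const_mul 4).mul (hB.pow 4))
      |>.sub (((hA.pow 8).const_mul 8).mul (hB.pow 4))))
  refine (hM.div (hD.pow 2) (pow_pos (addDen_pos (A t) (B t)) 2).ne').congr_deriv ?_
  rw [div_eq_zero_iff]
  left
  simp only [Pi.add_apply, Pi.mul_apply, Pi.pow_apply, Pi.sub_apply]
  generalize A t = a at *
  generalize B t = b at *
  generalize P t = p at *
  generalize Q t = q at *
  push_cast
  linear_combination
    (1 - 4 * b ^ 6 - 44 * a ^ 2 * b ^ 4 + 32 * a ^ 2 * b ^ 10 - 44 * a ^ 4 * b ^ 2 -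
      88 * a ^ 4 * b ^ 8 + 192 * a ^ 4 * b ^ 14 - 160 * a ^ 6 * b ^ 6 + 640 * a ^ 6 * b ^ 12 -
      144 * a ^ 8 * b ^ 4 + 1472 * a ^ 8 * b ^ 10 - 128 * a ^ 8 * b ^ 16 + 1088 * a ^ 10 * b ^ 8 +
      256 * a ^ 10 * b ^ 14 + 192 * a ^ 12 * b ^ 6 + 384 * a ^ 12 * b ^ 12) * hp +
    (-1 + 44 * a ^ 2 * b ^ 4 + 44 * a ^ 4 * b ^ 2 + 144 * a ^ 4 * b ^ 8 + 4 * a ^ 6 +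
      160 * a ^ 6 * b ^ 6 - 192 * a ^ 6 * b ^ 12 + 88 * a ^ 8 * b ^ 4 - 1088 * a ^ 8 * b ^ 10 -
      32 * a ^ 10 * b ^ 2 - 1472 * a ^ 10 * b ^ 8 - 640 * a ^ 12 * b ^ 6 - 384 * a ^ 12 * b ^ 12 -
      192 * a ^ 14 * b ^ 4 - 256 * a ^ 14 * b ^ 10 + 128 * a ^ 16 * b ^ 8) * hq

namespace IsSexticSine

variable {S : ℝ → ℝ} {ω : ℝ}

/-- The derivative `√(1 - S ^ 6)` of a sextic sine. -/
noncomputable def cosine (S : ℝ → ℝ) (z : ℝ) : ℝ := Real.sqrt (1 - S z ^ 6)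

lemma cosine_pos (hS : IsSexticSine S ω) {z : ℝ} (hz : z ∈ Ioo 0 ω) : 0 < cosine S z :=
  Real.sqrt_pos.mpr (one_sub_pow_six_pos (hS.mem_Ioo z hz))

lemma cosine_sq (hS : IsSexticSine S ω) {z : ℝ} (hz : z ∈ Ioc 0 ω) :
    cosine S z ^ 2 = 1 - S z ^ 6 := by
  refine Real.sq_sqrt ?_
  rcases hz.2.eq_or_lt with rfl | h
  · simp [hS.map_right]
  · exact (one_sub_pow_six_pos (hS.mem_Ioo z ⟨hz.1, h⟩)).le

lemma continuous_cosine (hS : IsSexticSine S ω) : Continuous (cosine S) := by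
  have := hS.continuous
  unfold cosine
  fun_prop

lemma hasDerivAt_cosine (hS : IsSexticSine S ω) {z : ℝ} (hz : z ∈ Ioo 0 ω) :
    HasDerivAt (cosine S) (-3 * S z ^ 5) z := by
  have hpos := one_sub_pow_six_pos (hS.mem_Ioo z hz)
  refine ((((hS.hasDerivAt z hz).pow 6).const_sub 1).sqrt hpos.ne').congr_deriv ?_
  have := Real.sqrt_pos.mpr hpos
  simp only [Pi.pow_apply]
  field_simp
  push_cast
  ring

lemma eq_of_hasDerivAt_zero {f : ℝ → ℝ} (hf : Continuous f) {c t : ℝ} (ht : t ∈ Ioo 0 c)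
    (h : ∀ u ∈ Ioo 0 c, HasDerivAt f 0 u) : f t = f 0 := by
  obtain ⟨u, -, hu⟩ := exists_hasDerivAt_eq_slope f (fun _ ↦ 0) ht.1 hf.continuousOn
    fun u hu ↦ h u ⟨hu.1, hu.2.trans ht.2⟩
  rw [eq_comm, div_eq_zero_iff] at hu
  rcases hu with hu | hu <;> linarith [ht.1]

lemma add_formulas (hS : IsSexticSine S ω) {z w : ℝ} (hz : 0 < z) (hw : 0 < w)
    (hzw : z + w ≤ ω) :
    addNum (S z) (S w) (cosine S z) (cosine S w) / addDen (S z) (S w) = S (z + w) ^ 2 ∧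
    addNum' (S z) (S w) (cosine S z) (cosine S w) / addDen (S z) (S w) ^ 2 =
      S (z + w) * cosine S (z + w) := by
  have hc := hS.continuous
  have hc' := hS.continuous_cosine
  have hden : ∀ t, addDen (S t) (S (z + w - t)) ≠ 0 := fun t ↦ (addDen_pos _ _).ne'
  have hden2 : ∀ t, addDen (S t) (S (z + w - t)) ^ 2 ≠ 0 := fun t ↦ pow_ne_zero _ (hden t)
  have hcD : Continuous fun t ↦ addDen (S t) (S (z + w - t)) := by unfold addDen; fun_prop
  have hcN : Continuous fun t ↦
      addNum (S t) (S (z + w - t)) (cosine S t) (cosine S (z + w - t)) := by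
    unfold addNum; fun_prop
  have hcN' : Continuous fun t ↦
      addNum' (S t) (S (z + w - t)) (cosine S t) (cosine S (z + w - t)) := by
    unfold addNum'; fun_prop
  have hz' : z ∈ Ioo 0 (z + w) := ⟨hz, by linarith⟩
  have hl : ∀ u ∈ Ioo 0 (z + w), u ∈ Ioo 0 ω := fun u hu ↦ ⟨hu.1, hu.2.trans_le hzw⟩
  have hr : ∀ u ∈ Ioo 0 (z + w), z + w - u ∈ Ioo 0 ω := fun u hu ↦
    ⟨by linarith [hu.2], by linarith [hu.1]⟩
  have hB : ∀ u ∈ Ioo 0 (z + w),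
      HasDerivAt (fun t ↦ S (z + w - t)) (-cosine S (z + w - u)) u := fun u hu ↦
    (hS.hasDerivAt _ (hr u hu)).comp_const_sub (z + w) u
  have hQ : ∀ u ∈ Ioo 0 (z + w),
      HasDerivAt (fun t ↦ cosine S (z + w - t)) (3 * S (z + w - u) ^ 5) u := fun u hu ↦
    ((hS.hasDerivAt_cosine (hr u hu)).comp_const_sub (z + w) u).congr_deriv (by ring)
  have h1 := eq_of_hasDerivAt_zero (hcN.div₀ hcD hden) hz' fun u hu ↦
    hasDerivAt_addNum_div_addDen (B := fun t ↦ S (z + w - t))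
    (hS.hasDerivAt u (hl u hu)) (hB u hu) (hS.hasDerivAt_cosine (hl u hu)) (hQ u hu)
    (hS.cosine_sq (Ioo_subset_Ioc_self (hl u hu))) (hS.cosine_sq (Ioo_subset_Ioc_self (hr u hu)))
  have h2 := eq_of_hasDerivAt_zero (hcN'.div₀ (hcD.pow 2) hden2) hz' fun u hu ↦
    hasDerivAt_addNum'_div_addDen_sq (B := fun t ↦ S (z + w - t))
    (hS.hasDerivAt u (hl u hu)) (hB u hu) (hS.hasDerivAt_cosine (hl u hu)) (hQ u hu)
    (hS.cosine_sq (Ioo_subset_Ioc_self (hl u hu))) (hS.cosine_sq (Ioo_subset_Ioc_self (hr u hu)))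
  simp only [Pi.pow_apply] at h2
  rw [add_sub_cancel_left] at h1 h2
  rw [h1, h2]
  simp [addNum, addNum', addDen, hS.map_zero]

end IsSexticSine

end AdditionFormula

section Curve

open WeierstrassCurve Affine

/-- The elliptic curve `y² = x³ - 1`. -/
def kiepertCurve : WeierstrassCurve.Affine ℚ := ⟨0, 0, 0, 0, -1⟩

lemma kiepertCurve_equation_iff {K : Type*} [Field K] [Algebra ℚ K] (x y : K) :
    (kiepertCurve⁄K).Equation x y ↔ y ^ 2 = x ^ 3 - 1 := by
  simp [WeierstrassCurve.Affine.equation_iff, kiepertCurve, WeierstrassCurve.baseChange,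
    WeierstrassCurve.map, sub_eq_add_neg]

lemma kiepertCurve_nonsingular_iff {K : Type*} [Field K] [Algebra ℚ K] (x y : K) :
    (kiepertCurve⁄K).Nonsingular x y ↔ y ^ 2 = x ^ 3 - 1 := by
  have : CharZero K := algebraRat.charZero K
  rw [WeierstrassCurve.Affine.nonsingular_iff, kiepertCurve_equation_iff, and_iff_left_iff_imp]
  intro h
  simp only [kiepertCurve, WeierstrassCurve.baseChange, WeierstrassCurve.map, map_zero]
  by_contra! H
  have hy : y = 0 := by
    have : 2 * y = 0 := by linear_combination H.2
    simpa using this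
  have hx : x = 0 := by
    have : 3 * x ^ 2 = 0 := by linear_combination -H.1
    simpa using this
  simp [hx, hy] at h

@[simp] lemma kiepertCurve_negY {K : Type*} [Field K] [Algebra ℚ K] (x y : K) :
    (kiepertCurve⁄K).negY x y = -y := by
  simp [negY, kiepertCurve, WeierstrassCurve.baseChange, WeierstrassCurve.map]

open IntermediateField

lemma nonempty_algHom_adjoin_simple {F L M : Type*} [Field F] [Field L] [Field M] [Algebra F L]
    [Algebra F M] [IsAlgClosed M] {y : L} (hy : IsIntegral F y) : Nonempty (F⟮y⟯ →ₐ[F] M) :=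
  have : Algebra.IsAlgebraic F F⟮y⟯ := isAlgebraic_adjoin_simple hy
  ⟨IsAlgClosed.lift⟩

lemma exists_algHom_map_eq {k L M : Type*} [Field k] [Field L] [Field M] [Algebra k L]
    [Algebra k M] [IsAlgClosed M] {x y : L} {x' : M} (hx : Transcendental k x)
    (hx' : Transcendental k x') (hy : IsIntegral k⟮x⟯ y) :
    ∃ (A : IntermediateField k L) (x₀ y₀ : A) (τ : A →ₐ[k] M),
      (x₀ : L) = x ∧ (y₀ : L) = y ∧ τ x₀ = x' := by
  let σ : k⟮x⟯ →ₐ[k] M := k⟮x'⟯.val.comp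
    ((RatFunc.algEquivOfTranscendental x' hx').toAlgHom.comp
      (RatFunc.algEquivOfTranscendental x hx).symm.toAlgHom)
  have hσ : σ (AdjoinSimple.gen k x) = x' := by
    have : (RatFunc.algEquivOfTranscendental x hx).symm (AdjoinSimple.gen k x) = RatFunc.X := by
      rw [AlgEquiv.symm_apply_eq]
      ext
      simp
    simp [σ, this]
  let : Algebra k⟮x⟯ M := σ.toRingHom.toAlgebra
  have : IsScalarTower k k⟮x⟯ M := .of_algebraMap_eq fun a ↦ (σ.commutes a).symm
  obtain ⟨τ⟩ : Nonempty (k⟮x⟯⟮y⟯ →ₐ[k⟮x⟯] M) := nonempty_algHom_adjoin_simple hy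
  exact ⟨k⟮x⟯⟮y⟯.restrictScalars k, algebraMap k⟮x⟯ k⟮x⟯⟮y⟯ (AdjoinSimple.gen k x),
    AdjoinSimple.gen k⟮x⟯ y, τ.restrictScalars k, rfl, rfl, (τ.commutes _).trans hσ⟩

lemma nsmul_eq_zero_of_transcendental {x y x' y' : ℝ} (h : (kiepertCurve⁄ℝ).Nonsingular x y)
    (h' : (kiepertCurve⁄ℝ).Nonsingular x' y') (hx : Transcendental ℚ x)
    (hx' : Transcendental ℚ x') (n : ℕ) (hn : n • Point.some x y h = 0) :
    n • Point.some x' y' h' = 0 := by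
  classical
  have hxy := (kiepertCurve_nonsingular_iff x y).mp h
  let κ : ℝ →ₐ[ℚ] ℂ := Complex.ofRealAm.restrictScalars ℚ
  have hint : IsIntegral ℚ⟮x⟯ y := by
    refine IsIntegral.of_pow two_pos ?_
    rw [hxy]
    exact ((isIntegral_algebraMap (x := AdjoinSimple.gen ℚ x)).pow 3).sub isIntegral_one
  obtain ⟨A, x₀, y₀, τ, rfl, rfl, hτ⟩ := exists_algHom_map_eq hx
    (mt (isAlgebraic_algHom_iff κ κ.injective).mp hx') hint
  have h₀ : (kiepertCurve⁄A).Nonsingular x₀ y₀ :=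
    (kiepertCurve.baseChange_nonsingular A.val.injective ..).mp h
  have hP₀ : n • Point.some x₀ y₀ h₀ = 0 := by
    apply Point.map_injective (W' := kiepertCurve) A.val
    rw [map_nsmul, map_zero]
    exact hn
  have h₁ : (kiepertCurve⁄ℂ).Nonsingular (τ x₀) (τ y₀) :=
    (kiepertCurve.baseChange_nonsingular τ.injective ..).mpr h₀
  have hP₁ : n • Point.some _ _ h₁ = 0 := by
    have := congrArg (Point.map (W' := kiepertCurve) τ) hP₀
    rwa [map_nsmul, map_zero] at this
  apply Point.map_injective (W' := kiepertCurve) κ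
  rw [map_nsmul, map_zero, Point.map_some]
  rcases Point.X_eq_iff (h₁ := (kiepertCurve.baseChange_nonsingular κ.injective ..).mpr h')
    (h₂ := h₁) |>.mp hτ.symm with H | H
  · rw [H, hP₁]
  · rw [H, smul_neg, hP₁, neg_zero]

end Curve

section DivisionPoints

open WeierstrassCurve Affine Set

lemma kiepertCurve_nonsingular_of_sq {a p : ℝ} (ha : a ≠ 0) (hp : p ^ 2 = 1 - a ^ 6) :
    (kiepertCurve⁄ℝ).Nonsingular (1 / a ^ 2) (p / a ^ 3) := by
  rw [kiepertCurve_nonsingular_iff]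
  field_simp
  linear_combination hp

lemma some_add_some_eq {a b p q s c : ℝ} (ha : 0 < a) (hb : 0 < b) (hs : 0 < s) (hp0 : 0 < p)
    (hq0 : 0 < q) (hp : p ^ 2 = 1 - a ^ 6) (hq : q ^ 2 = 1 - b ^ 6) (hc : c ^ 2 = 1 - s ^ 6)
    (hsq : addNum a b p q / addDen a b = s ^ 2)
    (hsc : addNum' a b p q / addDen a b ^ 2 = s * c) :
    Point.some _ _ (kiepertCurve_nonsingular_of_sq ha.ne' hp) +
      Point.some _ _ (kiepertCurve_nonsingular_of_sq hb.ne' hq) =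
    Point.some _ _ (kiepertCurve_nonsingular_of_sq hs.ne' hc) := by
  have hD := addDen_pos a b
  have hN : 0 < addNum a b p q := by
    have : 0 < addNum a b p q / addDen a b := hsq ▸ by positivity
    exact (div_pos_iff_of_pos_right hD).mp this
  have hx : 1 / s ^ 2 = addDen a b / addNum a b p q := by rw [← hsq, one_div_div]
  have hy : c / s ^ 3 = addNum' a b p q / addNum a b p q ^ 2 := by
    have : c / s ^ 3 = (s * c) / (s ^ 2) ^ 2 := by field_simp
    rw [this, ← hsq, ← hsc]
    field_simp
  have hne : ¬(1 / a ^ 2 = 1 / b ^ 2 ∧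
      p / a ^ 3 = (kiepertCurve⁄ℝ).negY (1 / b ^ 2) (q / b ^ 3)) := by
    rw [kiepertCurve_negY]
    rintro ⟨-, h⟩
    have h1 : 0 < p / a ^ 3 := by positivity
    have h2 : 0 < q / b ^ 3 := by positivity
    linarith
  rw [Point.add_some hne, Point.some.injEq, hx, hy, addY, negAddY, kiepertCurve_negY]
  have haddX : ∀ x₁ x₂ ℓ, (kiepertCurve⁄ℝ).addX x₁ x₂ ℓ = ℓ ^ 2 - x₁ - x₂ := by
    intros
    simp [addX, kiepertCurve, WeierstrassCurve.baseChange, WeierstrassCurve.map]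
  rcases eq_or_ne a b with rfl | hab
  · obtain rfl : p = q := by
      rw [← hq] at hp
      exact (pow_left_inj₀ hp0.le hq0.le two_ne_zero).mp hp
    have hslope : (kiepertCurve⁄ℝ).slope (1 / a ^ 2) (1 / a ^ 2) (p / a ^ 3) (p / a ^ 3) =
        3 / (2 * a * p) := by
      rw [slope_of_Y_ne rfl fun h ↦ hne ⟨rfl, h⟩, kiepertCurve_negY]
      simp only [kiepertCurve, WeierstrassCurve.baseChange, WeierstrassCurve.map, map_zero]
      field_simp
      ring
    have hNe : addNum a a p p = 4 * a ^ 2 * p ^ 2 := by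
      unfold addNum; linear_combination (-2 * a ^ 2) * hp
    have hX : (3 / (2 * a * p)) ^ 2 - 1 / a ^ 2 - 1 / a ^ 2 = addDen a a / addNum a a p p := by
      rw [hNe]
      unfold addDen
      field_simp
      linear_combination (-32) * hp
    rw [haddX, hslope, hX]
    refine ⟨rfl, ?_⟩
    have hM : addNum' a a p p = 2 * a * p * -(3 * (addDen a a - 4 * p ^ 2) + 8 * p ^ 4) := by
      unfold addDen addNum'
      linear_combination (-2 * a * p * (12 - 8 * (p ^ 2 + 1 - a ^ 6))) * hp
    rw [hNe, hM]
    field_simp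
    ring
  · have hab2 : b ^ 2 - a ^ 2 ≠ 0 := by
      rw [sub_ne_zero]
      exact fun h ↦ hab ((pow_left_inj₀ ha.le hb.le two_ne_zero).mp h.symm)
    have hX12 : 1 / a ^ 2 ≠ 1 / b ^ 2 := by
      intro h
      field_simp at h
      exact hab2 (by linear_combination h)
    have hslope : (kiepertCurve⁄ℝ).slope (1 / a ^ 2) (1 / b ^ 2) (p / a ^ 3) (q / b ^ 3) =
        (p * b ^ 3 - q * a ^ 3) / (a * b * (b ^ 2 - a ^ 2)) := by
      rw [slope_of_X_ne hX12]
      have : 1 / a ^ 2 - 1 / b ^ 2 = (b ^ 2 - a ^ 2) / (a ^ 2 * b ^ 2) := by field_simp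
      rw [this]
      field_simp
    have hX : ((p * b ^ 3 - q * a ^ 3) / (a * b * (b ^ 2 - a ^ 2))) ^ 2 - 1 / a ^ 2 - 1 / b ^ 2 =
        addDen a b / addNum a b p q := by
      have : ((p * b ^ 3 - q * a ^ 3) / (a * b * (b ^ 2 - a ^ 2))) ^ 2 - 1 / a ^ 2 - 1 / b ^ 2 =
        ((p * b ^ 3 - q * a ^ 3) ^ 2 - (a ^ 2 + b ^ 2) * (b ^ 2 - a ^ 2) ^ 2) /
          (a ^ 2 * b ^ 2 * (b ^ 2 - a ^ 2) ^ 2) := by field_simp; ring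
      rw [this, div_eq_div_iff (by positivity) hN.ne']
      unfold addDen addNum
      linear_combination
        (b ^ 8 + 2 * a * b ^ 7 * p * q + a ^ 2 * b ^ 6 - 4 * a ^ 4 * b ^ 4 * q ^ 2 -
          2 * a ^ 4 * b ^ 10) * hp +
        (-4 * a ^ 4 * b ^ 4 + a ^ 6 * b ^ 2 + 2 * a ^ 7 * b * p * q + a ^ 8 +
          2 * a ^ 10 * b ^ 4) * hq
    rw [haddX, hslope, hX]
    refine ⟨rfl, ?_⟩
    have key : -((p * b ^ 3 - q * a ^ 3) * (addDen a b * a ^ 2 - addNum a b p q) * addNum a b p q +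
        p * b * (b ^ 2 - a ^ 2) * addNum a b p q ^ 2) =
        addNum' a b p q * (a ^ 3 * b * (b ^ 2 - a ^ 2)) := by
      unfold addDen addNum addNum'
      linear_combination
        (2 * a ^ 3 * b ^ 4 * q + 4 * a ^ 4 * b ^ 3 * p * q ^ 2 + 4 * a ^ 5 * b ^ 2 * q -
          4 * a ^ 5 * b ^ 2 * q ^ 3 - 8 * a ^ 5 * b ^ 8 * q - 16 * a ^ 7 * b ^ 6 * q) * hp +
        (-4 * a ^ 5 * b ^ 2 * q - 2 * a ^ 6 * b * p + 16 * a ^ 8 * b ^ 5 * p +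
          4 * a ^ 10 * b ^ 3 * p + 4 * a ^ 11 * b ^ 2 * q) * hq
    rw [eq_div_iff (by positivity),
      ← mul_left_inj' (show a ^ 3 * b * (b ^ 2 - a ^ 2) ≠ 0 by positivity), ← key]
    field_simp

namespace IsSexticSine

variable {S : ℝ → ℝ} {ω : ℝ}

lemma pos (hS : IsSexticSine S ω) {z : ℝ} (hz : z ∈ Ioc 0 ω) : 0 < S z := by
  rcases hz.2.eq_or_lt with rfl | h
  · simp [hS.map_right]
  · exact (hS.mem_Ioo z ⟨hz.1, h⟩).1

/-- The point of `y² = x³ - 1` with parameter `z`. -/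
noncomputable def point (hS : IsSexticSine S ω) {z : ℝ} (hz : z ∈ Ioc 0 ω) :
    (kiepertCurve⁄ℝ).Point :=
  .some _ _ (kiepertCurve_nonsingular_of_sq (hS.pos hz).ne' (hS.cosine_sq hz))

lemma point_add_point (hS : IsSexticSine S ω) {z w : ℝ} (hz : z ∈ Ioc 0 ω) (hw : w ∈ Ioc 0 ω)
    (hzw : z + w ∈ Ioc 0 ω) : hS.point hz + hS.point hw = hS.point hzw :=
  have h := hS.add_formulas hz.1 hw.1 hzw.2
  some_add_some_eq (hS.pos hz) (hS.pos hw) (hS.pos hzw)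
    (hS.cosine_pos ⟨hz.1, by linarith [hw.1, hzw.2]⟩)
    (hS.cosine_pos ⟨hw.1, by linarith [hz.1, hzw.2]⟩)
    (hS.cosine_sq hz) (hS.cosine_sq hw) (hS.cosine_sq hzw) h.1 h.2

lemma nsmul_point (hS : IsSexticSine S ω) {z w : ℝ} (hz : z ∈ Ioc 0 ω) {n : ℕ} (hn : n ≠ 0)
    (hw : w ∈ Ioc 0 ω) (hnz : n * z = w) : n • hS.point hz = hS.point hw := by
  subst hnz
  induction n with
  | zero => exact absurd rfl hn
  | succ n ih =>
    rcases eq_or_ne n 0 with rfl | hn0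
    · simp
    · have hmem : (n : ℝ) * z ∈ Ioc 0 ω := by
        have := hz.1
        refine ⟨by positivity, le_trans ?_ hw.2⟩
        push_cast
        linarith
      rw [succ_nsmul, ih hn0 hmem, hS.point_add_point hmem hz
        (by convert hw using 1; push_cast; ring)]
      congr 1
      push_cast
      ring

lemma two_nsmul_point_right (hS : IsSexticSine S ω) (hω : ω ∈ Ioc 0 ω) :
    2 • hS.point hω = 0 := by
  rw [two_nsmul]
  exact Point.add_self_of_Y_eq (by rw [kiepertCurve_negY]; simp [cosine, hS.map_right])

end IsSexticSine

lemma transcendental_one_div_sq {x : ℝ} (hx : Transcendental ℚ x) :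
    Transcendental ℚ (1 / x ^ 2) := by
  rw [one_div]
  exact fun h ↦ hx ((IsAlgebraic.inv_iff.mp h).of_pow two_pos)

/-- If `1 ≤ l`, `i ≤ l` and `s ∈ [0,1]` satisfies
`∫₀ˢ dt/√(1-t⁶) = (i/l)·∫₀¹ dt/√(1-t⁶)`, then `s` is algebraic over `ℚ`.
(Hence the equal-length division points of the Kiepert curve `{z : |z³-1| = 1}` starting
from the origin are algebraic.) -/
theorem stmt_7 (l i : ℕ) (hl : 1 ≤ l) (hi : i ≤ l) (s : ℝ) (hs : s ∈ Set.Icc (0:ℝ) 1)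
    (h : (∫ t in (0:ℝ)..s, 1 / Real.sqrt (1 - t ^ 6)) =
      ((i : ℝ) / (l : ℝ)) * ∫ t in (0:ℝ)..1, 1 / Real.sqrt (1 - t ^ 6)) :
    IsAlgebraic ℚ s := by
  change sexticArc s = i / l * sexticArc 1 at h
  obtain ⟨S, hS, hinv⟩ := exists_isSexticSine
  have hmono := strictMonoOn_sexticArc
  have hω : 0 < sexticArc 1 := by
    simpa using hmono (by simp) (by simp) (zero_lt_one' ℝ)
  have hl0 : (0:ℝ) < l := by exact_mod_cast hl
  by_contra htr
  have hs0 : 0 < s := lt_of_le_of_ne hs.1 fun h0 ↦ htr (h0 ▸ isAlgebraic_zero)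
  have hF : sexticArc s ∈ Ioc 0 (sexticArc 1) :=
    ⟨by simpa using hmono (by simp) hs hs0, hmono.monotoneOn hs (by simp) hs.2⟩
  have hi0 : i ≠ 0 := by
    rintro rfl
    simp [h] at hF
  have hωl : sexticArc 1 / l ∈ Ioc 0 (sexticArc 1) :=
    ⟨by positivity, div_le_self hω.le (by exact_mod_cast hl)⟩
  have hωω : sexticArc 1 ∈ Ioc 0 (sexticArc 1) := ⟨hω, le_rfl⟩
  have htors : (2 * l) • hS.point hF = 0 := by
    rw [← hS.nsmul_point hωl hi0 hF (by rw [h]; ring), smul_comm, mul_smul,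
      hS.nsmul_point hωl (by omega) hωω (by field_simp), hS.two_nsmul_point_right, nsmul_zero]
  have hω2l : sexticArc 1 / (2 * l) ∈ Ioo 0 (sexticArc 1) :=
    ⟨by positivity, div_lt_self hω (by have : (1:ℝ) ≤ l := by exact_mod_cast hl
                                       linarith)⟩
  obtain ⟨t, ht, htt⟩ := ((Algebraic.countable ℚ ℝ).dense_compl ℝ).exists_between
    (hS.mem_Ioo _ hω2l).1
  have ht1 : t ∈ Icc (0:ℝ) 1 := ⟨htt.1.le, (htt.2.trans (hS.mem_Ioo _ hω2l).2).le⟩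
  have hSt : S (sexticArc t) = t := hinv t ht1
  have htF : 0 < sexticArc t := by simpa using hmono (by simp) ht1 htt.1
  have htlt : sexticArc t < sexticArc 1 / (2 * l) := by
    obtain ⟨u, hu, hu'⟩ := image_sexticArc ▸ Ioo_subset_Icc_self hω2l
    rw [← hu', hinv u hu] at htt
    rw [← hu']
    exact hmono ht1 hu htt.2
  rw [lt_div_iff₀ (by positivity)] at htlt
  have hmem : sexticArc t ∈ Ioc 0 (sexticArc 1) := ⟨htF, hmono.monotoneOn ht1 (by simp) ht1.2⟩
  have hmem2 : ((2 * l : ℕ) : ℝ) * sexticArc t ∈ Ioc 0 (sexticArc 1) := by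
    push_cast
    exact ⟨by positivity, by linarith⟩
  have hzero : (2 * l) • hS.point hmem = 0 :=
    nsmul_eq_zero_of_transcendental _ _ (transcendental_one_div_sq (by rwa [hinv s hs]))
      (transcendental_one_div_sq (by rwa [hSt])) _ htors
  rw [hS.nsmul_point hmem (by omega) hmem2 rfl] at hzero
  exact Point.some_ne_zero _ hzero

end DivisionPoints
end

section
/- Let l ≥ 1 and i be natural numbers with 0 ≤ i ≤ l, and let s ∈ [0,1] be a real number satisfying ∫₀^s dt/√(1 − t⁴) = (i/l)·∫₀¹ dt/√(1 − t⁴). Then s is algebraic over ℚ. Consequently, the points dividing Bernoulli's lemniscate {z ∈ ℂ : |z² − 1| = 1} into parts of equal length starting from the origin have algebraic coordinates. -/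
open Real Polynomial

namespace Lemniscate

/-- The lemniscatic arc length in the angle variable `θ`, where `t = sin θ`. -/
noncomputable def arc (θ : ℝ) : ℝ := ∫ φ in (0 : ℝ)..θ, 1 / √(1 + sin φ ^ 2)

lemma one_add_sin_sq_pos (θ : ℝ) : 0 < 1 + sin θ ^ 2 := by positivity

lemma continuous_arc_integrand : Continuous fun φ : ℝ => 1 / √(1 + sin φ ^ 2) :=
  continuous_const.div (by fun_prop) fun φ => (sqrt_pos.2 (one_add_sin_sq_pos φ)).ne'

lemma hasDerivAt_arc (θ : ℝ) : HasDerivAt arc (1 / √(1 + sin θ ^ 2)) θ :=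
  continuous_arc_integrand.integral_hasStrictDerivAt 0 θ |>.hasDerivAt

lemma continuous_arc : Continuous arc :=
  continuous_iff_continuousAt.2 fun θ => (hasDerivAt_arc θ).continuousAt

@[simp] lemma arc_zero : arc 0 = 0 := by simp [arc]

lemma arc_neg (θ : ℝ) : arc (-θ) = -arc θ := by
  have h := intervalIntegral.integral_comp_neg (a := 0) (b := θ)
    (fun φ : ℝ => 1 / √(1 + sin φ ^ 2))
  simp only [sin_neg, neg_sq, neg_zero] at h
  rw [arc, arc, h, intervalIntegral.integral_symm]

lemma strictMono_arc : StrictMono arc :=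
  strictMono_of_hasDerivAt_pos hasDerivAt_arc
    fun θ => one_div_pos.2 (sqrt_pos.2 (one_add_sin_sq_pos θ))

lemma half_le_arc {θ : ℝ} (hθ : 0 ≤ θ) : θ / 2 ≤ arc θ := by
  have hmono : Monotone fun x => arc x - x / 2 := by
    refine monotone_of_hasDerivAt_nonneg (f' := fun x => 1 / √(1 + sin x ^ 2) - 1 / 2)
      (fun x => (hasDerivAt_arc x).sub ((hasDerivAt_id x).div_const 2)) fun x => ?_
    have h : √(1 + sin x ^ 2) ≤ 2 := by
      rw [sqrt_le_left (by norm_num)]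
      nlinarith [sin_sq_le_one x]
    exact sub_nonneg.2 (one_div_le_one_div_of_le (sqrt_pos.2 (one_add_sin_sq_pos x)) h)
  have := hmono hθ
  simp only [arc_zero] at this
  linarith

lemma surjective_arc : Function.Surjective arc := by
  intro y
  have h := half_le_arc (θ := 2 * |y|) (by positivity)
  have h' := arc_neg (2 * |y|)
  obtain ⟨x, -, hx⟩ := intermediate_value_Icc (a := -(2 * |y|)) (b := 2 * |y|)
    (by linarith [abs_nonneg y]) continuous_arc.continuousOn
    (show y ∈ _ from ⟨by linarith [neg_abs_le y], by linarith [le_abs_self y]⟩)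
  exact ⟨x, hx⟩

/-- The lemniscatic amplitude, the inverse of `arc`. -/
noncomputable def amp : ℝ ≃o ℝ := (strictMono_arc.orderIsoOfSurjective arc surjective_arc).symm

lemma arc_amp (x : ℝ) : arc (amp x) = x :=
  (strictMono_arc.orderIsoOfSurjective arc surjective_arc).apply_symm_apply x

lemma amp_arc (θ : ℝ) : amp (arc θ) = θ :=
  (strictMono_arc.orderIsoOfSurjective arc surjective_arc).symm_apply_apply θ

lemma hasDerivAt_amp (x : ℝ) : HasDerivAt amp (√(1 + sin (amp x) ^ 2)) x := by
  have h := HasDerivAt.of_local_left_inverse amp.continuous.continuousAt (hasDerivAt_arc (amp x))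
    (one_div_pos.2 (sqrt_pos.2 (one_add_sin_sq_pos _))).ne' (.of_forall arc_amp)
  simpa using h

lemma amp_neg (x : ℝ) : amp (-x) = -amp x :=
  strictMono_arc.injective (by rw [arc_neg, arc_amp, arc_amp])

/-- The lemniscate sine. -/
noncomputable def sl (x : ℝ) : ℝ := sin (amp x)

/-- The derivative of the lemniscate sine. -/
noncomputable def sl' (x : ℝ) : ℝ := cos (amp x) * √(1 + sin (amp x) ^ 2)

lemma sl_arc (θ : ℝ) : sl (arc θ) = sin θ := by rw [sl, amp_arc]

@[simp] lemma sl_zero : sl 0 = 0 := by simpa using sl_arc 0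

@[simp] lemma sl'_zero : sl' 0 = 1 := by
  have : amp 0 = 0 := by simpa using amp_arc 0
  simp [sl', this]

lemma sl_neg (x : ℝ) : sl (-x) = -sl x := by rw [sl, amp_neg, sin_neg, sl]

lemma sl'_neg (x : ℝ) : sl' (-x) = sl' x := by simp [sl', amp_neg]

lemma sl'_sq (x : ℝ) : sl' x ^ 2 = 1 - sl x ^ 4 := by
  rw [sl', sl, mul_pow, sq_sqrt (one_add_sin_sq_pos _).le, cos_sq']
  ring

lemma hasDerivAt_sl (x : ℝ) : HasDerivAt sl (sl' x) x := (hasDerivAt_amp x).sin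

lemma hasDerivAt_sl' (x : ℝ) : HasDerivAt sl' (-2 * sl x ^ 3) x := by
  have hpos := one_add_sin_sq_pos (amp x)
  have h0 := (sqrt_pos.2 hpos).ne'
  have hsq := sq_sqrt hpos.le
  have h := (hasDerivAt_amp x).cos.mul
    ((((hasDerivAt_amp x).sin.pow 2).const_add 1).sqrt hpos.ne')
  refine h.congr_deriv ?_
  simp only [sl, Pi.pow_apply]
  field_simp
  have hc := cos_sq' (amp x)
  push_cast
  simp only [hsq, hc]
  ring

lemma one_add_sq_mul_sq_pos (a b : ℝ) : 0 < 1 + a ^ 2 * b ^ 2 := by positivity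

lemma sl_add (x y : ℝ) :
    sl (x + y) = (sl x * sl' y + sl y * sl' x) / (1 + sl x ^ 2 * sl y ^ 2) := by
  set a := x + y with ha
  let f : ℝ → ℝ := fun t =>
    (sl t * sl' (a - t) + sl (a - t) * sl' t) / (1 + sl t ^ 2 * sl (a - t) ^ 2)
  have hf : ∀ t, HasDerivAt f 0 t := by
    intro t
    have hr : HasDerivAt (fun t => a - t) (-1) t := (hasDerivAt_id t).const_sub a
    have h1 := hasDerivAt_sl t
    have h2 := hasDerivAt_sl' t
    have h3 : HasDerivAt (fun t => sl (a - t)) _ t := (hasDerivAt_sl (a - t)).comp t hr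
    have h4 : HasDerivAt (fun t => sl' (a - t)) _ t := (hasDerivAt_sl' (a - t)).comp t hr
    have h := ((h1.mul h4).add (h3.mul h2)).div (((h1.pow 2).mul (h3.pow 2)).const_add 1)
      (one_add_sq_mul_sq_pos (sl t) (sl (a - t))).ne'
    refine h.congr_deriv ?_
    simp only [Pi.add_apply, Pi.mul_apply, Pi.pow_apply]
    rw [div_eq_zero_iff]
    left
    have e1 := sl'_sq t
    have e2 := sl'_sq (a - t)
    push_cast
    linear_combination (-2 * sl t * sl (a - t) ^ 3) * e1 + (2 * sl t ^ 3 * sl (a - t)) * e2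
  have hconst : f 0 = f x := is_const_of_deriv_eq_zero (fun t => (hf t).differentiableAt)
    (fun t => (hf t).deriv) 0 x
  simpa [f, show a - x = y by rw [ha]; ring] using hconst

/-- A three-term recursion for the squares of `sl` along an arithmetic progression. -/
lemma sl_add_sq (x y : ℝ) :
    sl (x + y) ^ 2 = 4 * sl x ^ 2 * (1 - sl y ^ 4) / (1 + sl x ^ 2 * sl y ^ 2) ^ 2
      - 2 * (sl x ^ 2 - sl y ^ 2) / (1 + sl x ^ 2 * sl y ^ 2) - sl (x - y) ^ 2 := by
  have h0 := (one_add_sq_mul_sq_pos (sl x) (sl y)).ne'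
  have e1 := sl'_sq x
  have e2 := sl'_sq y
  rw [sub_eq_add_neg x y, sl_add, sl_add, sl_neg, sl'_neg, neg_sq]
  field_simp
  linear_combination (2 * sl y ^ 2) * e1 + (2 * sl x ^ 2) * e2

/-- `sl (n u) ^ 2` is a rational function of `sl u` with rational coefficients and no real poles
on the range of `sl`. -/
lemma exists_sl_nat_mul_sq (n : ℕ) : ∃ N D : ℚ[X], ∀ u : ℝ,
    aeval (sl u) D ≠ 0 ∧ sl (n * u) ^ 2 * aeval (sl u) D = aeval (sl u) N := by
  induction n using Nat.twoStepInduction with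
  | zero => exact ⟨0, 1, by simp⟩
  | one => exact ⟨X ^ 2, 1, by simp⟩
  | more n ih₀ ih₁ =>
    obtain ⟨N₀, D₀, h₀⟩ := ih₀
    obtain ⟨N, D, h₁⟩ := ih₁
    refine ⟨4 * N * D * (1 - X ^ 4) * D₀ - 2 * (N - X ^ 2 * D) * (D + N * X ^ 2) * D₀
      - N₀ * (D + N * X ^ 2) ^ 2, (D + N * X ^ 2) ^ 2 * D₀, fun u => ?_⟩
    obtain ⟨hD₀, hN₀⟩ := h₀ u
    obtain ⟨hD, hN⟩ := h₁ u
    have h := sl_add_sq ((n + 1 : ℕ) * u) u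
    rw [show ((n + 1 : ℕ) : ℝ) * u + u = (n + 2 : ℕ) * u by push_cast; ring,
      show ((n + 1 : ℕ) : ℝ) * u - u = n * u by push_cast; ring] at h
    have hpos := (one_add_sq_mul_sq_pos (sl ((n + 1 : ℕ) * u)) (sl u)).ne'
    simp only [map_sub, map_mul, map_add, map_pow, aeval_X, map_one, map_ofNat, ← hN, ← hN₀, h]
    set d := aeval (sl u) D
    set a := sl ((n + 1 : ℕ) * u)
    have hE : d + a ^ 2 * d * sl u ^ 2 = d * (1 + a ^ 2 * sl u ^ 2) := by ring
    rw [hE]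
    refine ⟨by positivity, ?_⟩
    field_simp

lemma isAlgebraic_sl_of_nat_mul_eq {l i : ℕ} (hl : l ≠ 0) {u ω : ℝ} (hω : sl ω = 1)
    (h : l * u = i * ω) : IsAlgebraic ℚ (sl u) := by
  obtain ⟨A, B, hAB⟩ := exists_sl_nat_mul_sq i
  obtain ⟨N, D, hND⟩ := exists_sl_nat_mul_sq l
  obtain ⟨q, hq⟩ : ∃ q : ℚ, sl (i * ω) ^ 2 = q := by
    obtain ⟨hB, hA⟩ := hAB ω
    have hev (p : ℚ[X]) : aeval (1 : ℝ) p = (p.eval 1 : ℚ) := by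
      simpa using aeval_algebraMap_apply_eq_algebraMap_eval (A := ℝ) (1 : ℚ) p
    rw [hω, hev] at hB hA
    rw [hev] at hA
    refine ⟨A.eval 1 / B.eval 1, ?_⟩
    push_cast
    rw [eq_div_iff hB, hA]
  have key (v : ℝ) : aeval (sl v) (N - C q * D) = (sl (l * v) ^ 2 - q) * aeval (sl v) D := by
    rw [map_sub, map_mul, aeval_C, ← (hND v).2, eq_ratCast]
    ring
  refine ⟨N - C q * D, fun hP => ?_, by rw [key, h, hq, sub_self, zero_mul]⟩
  have hconst (v : ℝ) : sl (l * v) ^ 2 = q := by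
    have hv := key v
    rw [hP, map_zero, eq_comm, mul_eq_zero, or_iff_left (hND v).1] at hv
    exact sub_eq_zero.1 hv
  have hzero := hconst 0
  have hone := hconst (ω / l)
  rw [mul_div_cancel₀ _ (Nat.cast_ne_zero.2 hl), hω, ← hzero] at hone
  simp at hone

lemma integral_eq_arc_arcsin {s : ℝ} (hs : s ∈ Set.Icc (0 : ℝ) 1) :
    ∫ t in (0 : ℝ)..s, 1 / √(1 - t ^ 4) = arc (arcsin s) := by
  have hcont : ContinuousOn (fun t => arc (arcsin t)) (Set.Icc 0 s) :=
    (continuous_arc.comp continuous_arcsin).continuousOn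
  have hderiv : ∀ t ∈ Set.Ioo 0 s,
      HasDerivAt (fun t => arc (arcsin t)) (1 / √(1 - t ^ 4)) t := by
    intro t ht
    have h0 : -1 < t := by linarith [ht.1]
    have h1 : t < 1 := ht.2.trans_le hs.2
    refine ((hasDerivAt_arc (arcsin t)).comp t (hasDerivAt_arcsin h0.ne' h1.ne)).congr_deriv ?_
    rw [sin_arcsin h0.le h1.le, one_div_mul_one_div, ← sqrt_mul (by positivity)]
    ring_nf
  have hint := intervalIntegral.integrableOn_deriv_of_nonneg hcont hderiv
    fun t _ => by positivity
  rw [intervalIntegral.integral_eq_sub_of_hasDerivAt_of_le hs.1 hcont hderiv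
    ((intervalIntegrable_iff_integrableOn_Ioc_of_le hs.1).2 hint)]
  simp

end Lemniscate


/-- If `1 ≤ l`, `i ≤ l` and `s ∈ [0,1]` satisfies
`∫₀ˢ dt/√(1-t⁴) = (i/l)·∫₀¹ dt/√(1-t⁴)`, then `s` is algebraic over `ℚ`.
(Hence the equal-length division points of the Bernoulli lemniscate `{z : |z²-1| = 1}` starting
from the origin are algebraic.) -/
theorem stmt_8 (l i : ℕ) (hl : 1 ≤ l) (hi : i ≤ l) (s : ℝ) (hs : s ∈ Set.Icc (0:ℝ) 1)
    (h : (∫ t in (0:ℝ)..s, 1 / Real.sqrt (1 - t ^ 4)) =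
      ((i : ℝ) / (l : ℝ)) * ∫ t in (0:ℝ)..1, 1 / Real.sqrt (1 - t ^ 4)) :
    IsAlgebraic ℚ s := by
  have hl' : l ≠ 0 := by omega
  rw [Lemniscate.integral_eq_arc_arcsin hs,
    Lemniscate.integral_eq_arc_arcsin (by simp), arcsin_one] at h
  have hu : Lemniscate.sl (Lemniscate.arc (arcsin s)) = s := by
    rw [Lemniscate.sl_arc, sin_arcsin (by linarith [hs.1]) hs.2]
  rw [← hu]
  refine Lemniscate.isAlgebraic_sl_of_nat_mul_eq (i := i) hl'
    (ω := Lemniscate.arc (π / 2)) (by rw [Lemniscate.sl_arc, sin_pi_div_two]) ?_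
  rw [h]
  field_simp
end

section
/- Let l ≥ 1 and i be natural numbers with 0 ≤ i ≤ l, and let s ∈ [0,1] be a real number satisfying ∫₀^s dt/√(1 − t³) = (i/l)·∫₀¹ dt/√(1 − t³). Then s is algebraic over ℚ. Consequently, the points dividing the sinusoidal spiral with polar equation r^{3/2} = 2cos((3/2)θ) into parts of equal length starting from the origin have algebraic coordinates. -/
open Set Filter Topology Polynomial

/-- The expression `m² + x₁ + x₂`, where `m` is the slope of the chord through the points
`(x₁, y₁)` and `(x₂, y₂)` of the curve `y² = 1 - x³`. -/
def chordSum {A : Type*} [Field A] (x₁ y₁ x₂ y₂ : A) : A :=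
  ((x₁ ^ 2 + x₁ * x₂ + x₂ ^ 2) / (y₁ + y₂)) ^ 2 + x₁ + x₂

section Algebraic

variable {R A : Type*} [CommRing R] [IsDomain R] [Field A] [Algebra R A]

theorem isAlgebraic_ordinate {x y : A} (hx : IsAlgebraic R x) (h : y ^ 2 = 1 - x ^ 3) :
    IsAlgebraic R y :=
  IsAlgebraic.of_pow two_pos (h ▸ isAlgebraic_one.sub (hx.pow 3))

theorem isAlgebraic_of_quadratic [CharZero A] {j x : A} (hj : IsAlgebraic R j)
    (h : j ^ 2 * x ^ 2 + 4 * x - 4 * j = 0) : IsAlgebraic R x := by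
  have hn (n : ℕ) : IsAlgebraic R (n : A) := isAlgebraic_natCast n
  by_cases hj0 : j = 0
  · have hx : x = 0 := by
      subst hj0
      simpa using h
    exact hx ▸ isAlgebraic_zero
  have h1 : IsAlgebraic R (j ^ 2 * x + (2 : ℕ)) := by
    refine IsAlgebraic.of_pow two_pos ?_
    have : (j ^ 2 * x + (2 : ℕ)) ^ 2 = (4 : ℕ) + (4 : ℕ) * j ^ 3 := by
      push_cast
      linear_combination j ^ 2 * h
    rw [this]
    exact (hn 4).add ((hn 4).mul (hj.pow 3))
  have h2 : x = (j ^ 2 * x + (2 : ℕ) - (2 : ℕ)) * (j ^ 2)⁻¹ := by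
    field_simp
    ring
  rw [h2]
  exact (h1.sub (hn 2)).mul (hj.pow 2).inv

theorem isAlgebraic_chordSum {x₁ y₁ x₂ y₂ : A} (hx₁ : IsAlgebraic R x₁) (hx₂ : IsAlgebraic R x₂)
    (h₁ : y₁ ^ 2 = 1 - x₁ ^ 3) (h₂ : y₂ ^ 2 = 1 - x₂ ^ 3) :
    IsAlgebraic R (chordSum x₁ y₁ x₂ y₂) := by
  have hy₁ := isAlgebraic_ordinate hx₁ h₁
  have hy₂ := isAlgebraic_ordinate hx₂ h₂
  rw [chordSum, div_eq_mul_inv]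
  exact ((((((hx₁.pow 2).add (hx₁.mul hx₂)).add (hx₂.pow 2)).mul (hy₁.add hy₂).inv).pow 2).add
    hx₁).add hx₂

/-- The multiples of a point with algebraic abscissa have algebraic abscissas. -/
theorem isAlgebraic_multiples [CharZero A] {l : ℕ} {x y : ℕ → A} (h0 : x 0 = 0) (h1 : IsAlgebraic R (x 1))
    (hy : ∀ k ≤ l, y k ^ 2 = 1 - x k ^ 3)
    (hadd : ∀ k, k + 1 ≤ l → chordSum (x k) (y k) (x 1) (y 1) ^ 2 * x (k + 1) ^ 2 +
      4 * x (k + 1) - 4 * chordSum (x k) (y k) (x 1) (y 1) = 0) :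
    ∀ k ≤ l, IsAlgebraic R (x k) := by
  intro k
  induction k with
  | zero => exact fun _ => h0 ▸ isAlgebraic_zero
  | succ k ih =>
    intro hk
    exact isAlgebraic_of_quadratic
      (isAlgebraic_chordSum (ih (by lia)) h1 (hy k (by lia)) (hy 1 (by lia))) (hadd k hk)

end Algebraic

theorem continuous_aevalAeval (q : ℤ[X][X]) :
    Continuous fun z : ℝ × ℝ => aevalAeval z.1 z.2 q := by
  induction q using Polynomial.induction_on' with
  | add p q hp hq =>
    simp only [map_add]
    exact hp.add hq
  | monomial n a =>
    have := (Polynomial.continuous_aeval (A := ℝ) a).comp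
      (continuous_fst (X := ℝ) (Y := ℝ))
    simp only [← C_mul_X_pow_eq_monomial, map_mul, map_pow, aevalAeval_C, aevalAeval_Y]
    exact this.mul (continuous_snd.pow n)

theorem aevalAeval_one_right (a : ℝ) (q : ℤ[X][X]) :
    aevalAeval a 1 q = aeval a (q.eval 1) := by
  induction q using Polynomial.induction_on' with
  | add p q hp hq => simp only [map_add, eval_add, hp, hq]
  | monomial n p =>
    simp only [← C_mul_X_pow_eq_monomial, map_mul, map_pow, aevalAeval_C, aevalAeval_Y,
      eval_mul, eval_C, eval_pow, eval_X, one_pow, map_one]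

theorem exists_continuousOn_inverse {f : ℝ → ℝ} {a b : ℝ} (hab : a ≤ b)
    (hf : ContinuousOn f (Icc a b)) (hm : StrictMonoOn f (Icc a b)) :
    ∃ g : ℝ → ℝ, ContinuousOn g (Icc (f a) (f b)) ∧ StrictMonoOn g (Icc (f a) (f b)) ∧
      (∀ u ∈ Icc (f a) (f b), g u ∈ Icc a b ∧ f (g u) = u) ∧ ∀ x ∈ Icc a b, g (f x) = x := by
  have hsurj : SurjOn f (Icc a b) (Icc (f a) (f b)) := intermediate_value_Icc hab hf
  have hmaps : ∀ x ∈ Icc a b, f x ∈ Icc (f a) (f b) := fun x hx =>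
    ⟨hm.monotoneOn (left_mem_Icc.2 hab) hx hx.1, hm.monotoneOn hx (right_mem_Icc.2 hab) hx.2⟩
  set g := Function.invFunOn f (Icc a b)
  have hg : ∀ u ∈ Icc (f a) (f b), g u ∈ Icc a b ∧ f (g u) = u := fun u hu =>
    ⟨hsurj.mapsTo_invFunOn hu, hsurj.rightInvOn_invFunOn hu⟩
  have hgf : ∀ x ∈ Icc a b, g (f x) = x := fun x hx => hm.injOn.leftInvOn_invFunOn hx
  refine ⟨g, ?_, ?_, hg, hgf⟩
  · rw [continuousOn_iff_isClosed]
    intro t ht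
    refine ⟨f '' (t ∩ Icc a b), ?_, ?_⟩
    · exact ((isCompact_Icc.inter_left ht).image_of_continuousOn
        (hf.mono inter_subset_right)).isClosed
    · ext u
      constructor
      · rintro ⟨hu, hu'⟩
        exact ⟨⟨g u, ⟨hu, (hg u hu').1⟩, (hg u hu').2⟩, hu'⟩
      · rintro ⟨⟨x, ⟨hx, hx'⟩, rfl⟩, hu'⟩
        exact ⟨by simpa [hgf x hx'] using hx, hu'⟩
  · intro u hu v hv huv
    rw [← hm.lt_iff_lt (hg u hu).1 (hg v hv).1, (hg u hu).2, (hg v hv).2]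
    exact huv

theorem one_sub_cube_pos {t : ℝ} (ht : t < 1) : 0 < 1 - t ^ 3 := by
  nlinarith [mul_pos (sub_pos.2 ht)
    (show 0 < t ^ 2 + t + 1 by nlinarith [sq_nonneg (t + 1), sq_nonneg t])]

theorem intervalIntegrable_one_div_sqrt_one_sub_cube :
    IntervalIntegrable (fun t : ℝ => 1 / √(1 - t ^ 3)) MeasureTheory.volume 0 1 := by
  have h : IntervalIntegrable (fun t : ℝ => (1 - t) ^ (-(1 / 2) : ℝ)) MeasureTheory.volume 0 1 := by
    have := (intervalIntegral.intervalIntegrable_rpow' (a := 1) (b := 0) (r := -(1 / 2))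
      (by norm_num)).comp_sub_left 1
    simpa using this
  refine h.mono_fun' (Measurable.aestronglyMeasurable (by fun_prop)) ?_
  rw [uIoc_of_le zero_le_one]
  filter_upwards [MeasureTheory.ae_restrict_mem measurableSet_Ioc] with t ht
  rcases ht.2.eq_or_lt with rfl | h1
  · norm_num
  · have : 0 < 1 - t := sub_pos.2 h1
    rw [Real.norm_of_nonneg (by positivity), Real.rpow_neg this.le, ← Real.sqrt_eq_rpow,
      one_div]
    gcongr
    nlinarith [ht.1, mul_pos ht.1 ht.1, pow_pos ht.1 3]

theorem continuousOn_arcLength :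
    ContinuousOn (fun x : ℝ => ∫ t in (0 : ℝ)..x, 1 / √(1 - t ^ 3)) (Icc 0 1) := by
  have := intervalIntegral.continuousOn_primitive_interval'
    intervalIntegrable_one_div_sqrt_one_sub_cube left_mem_uIcc
  rwa [uIcc_of_le zero_le_one] at this

theorem hasDerivAt_arcLength {x : ℝ} (h0 : 0 ≤ x) (h1 : x < 1) :
    HasDerivAt (fun x : ℝ => ∫ t in (0 : ℝ)..x, 1 / √(1 - t ^ 3)) (1 / √(1 - x ^ 3)) x := by
  refine intervalIntegral.integral_hasDerivAt_right ?_ ?_ ?_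
  · refine intervalIntegrable_one_div_sqrt_one_sub_cube.mono_set ?_
    rw [uIcc_of_le h0, uIcc_of_le zero_le_one]
    exact Icc_subset_Icc_right h1.le
  · exact Measurable.stronglyMeasurable (by fun_prop) |>.stronglyMeasurableAtFilter
  · have := (Real.sqrt_pos.2 (one_sub_cube_pos h1)).ne'
    fun_prop (disch := assumption)

theorem strictMonoOn_arcLength :
    StrictMonoOn (fun x : ℝ => ∫ t in (0 : ℝ)..x, 1 / √(1 - t ^ 3)) (Icc 0 1) := by
  refine strictMonoOn_of_deriv_pos (convex_Icc 0 1) continuousOn_arcLength fun x hx => ?_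
  rw [interior_Icc] at hx
  rw [(hasDerivAt_arcLength hx.1.le hx.2).deriv]
  exact one_div_pos.2 (Real.sqrt_pos.2 (one_sub_cube_pos hx.2))

/-- `F` inverts `x ↦ ∫₀ˣ dt/√(1 - t³)` on `[0, 1]`, with `K` the value of the integral at `1`. -/
structure IsArcLengthInverse (F : ℝ → ℝ) (K : ℝ) : Prop where
  continuousOn : ContinuousOn F (Icc 0 K)
  strictMonoOn : StrictMonoOn F (Icc 0 K)
  mem_Icc : ∀ u ∈ Icc 0 K, F u ∈ Icc (0 : ℝ) 1
  map_zero : F 0 = 0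
  map_right : F K = 1
  pos : 0 < K
  hasDerivAt : ∀ u ∈ Ioo 0 K, HasDerivAt F (√(1 - F u ^ 3)) u

theorem exists_isArcLengthInverse :
    ∃ F : ℝ → ℝ, IsArcLengthInverse F (∫ t in (0 : ℝ)..1, 1 / √(1 - t ^ 3)) ∧
      ∀ x ∈ Icc (0 : ℝ) 1, F (∫ t in (0 : ℝ)..x, 1 / √(1 - t ^ 3)) = x := by
  obtain ⟨F, hc, hm, hF, hinv⟩ :=
    exists_continuousOn_inverse zero_le_one continuousOn_arcLength strictMonoOn_arcLength
  have hpos := strictMonoOn_arcLength (left_mem_Icc.2 zero_le_one) (right_mem_Icc.2 zero_le_one)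
    one_pos
  simp only [intervalIntegral.integral_same] at hc hm hF hpos
  have h0 : F 0 = 0 := by simpa using hinv 0 (by simp)
  have h1 := hinv 1 (by simp)
  refine ⟨F, ⟨hc, hm, fun u hu => (hF u hu).1, h0, h1, hpos, fun u hu => ?_⟩, hinv⟩
  have hu' := Ioo_subset_Icc_self hu
  have hlt : F u < 1 := h1 ▸ hm hu' (right_mem_Icc.2 hpos.le) hu.2
  have hs := Real.sqrt_pos.2 (one_sub_cube_pos hlt)
  have := HasDerivAt.of_local_left_inverse (hc.continuousAt (Icc_mem_nhds hu.1 hu.2))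
    (hasDerivAt_arcLength (hF u hu').1.1 hlt) (by positivity)
    (by filter_upwards [Icc_mem_nhds hu.1 hu.2] with v hv using (hF v hv).2)
  simpa using this

namespace IsArcLengthInverse

variable {F : ℝ → ℝ} {K : ℝ}

theorem lt_one (H : IsArcLengthInverse F K) {u : ℝ} (h0 : 0 ≤ u) (hu : u < K) : F u < 1 :=
  H.map_right ▸ H.strictMonoOn ⟨h0, hu.le⟩ (right_mem_Icc.2 H.pos.le) hu

theorem sq_ordinate (H : IsArcLengthInverse F K) {u : ℝ} (hu : u ∈ Icc 0 K) :
    √(1 - F u ^ 3) ^ 2 = 1 - F u ^ 3 :=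
  Real.sq_sqrt (sub_nonneg.2 (pow_le_one₀ (H.mem_Icc u hu).1 (H.mem_Icc u hu).2))

theorem ordinate_pos (H : IsArcLengthInverse F K) {u : ℝ} (h0 : 0 ≤ u) (hu : u < K) :
    0 < √(1 - F u ^ 3) :=
  Real.sqrt_pos.2 (one_sub_cube_pos (H.lt_one h0 hu))

theorem hasDerivAt_ordinate (H : IsArcLengthInverse F K) {u : ℝ} (hu : u ∈ Ioo 0 K) :
    HasDerivAt (fun u => √(1 - F u ^ 3)) (-(3 / 2) * F u ^ 2) u := by
  have hy := H.ordinate_pos hu.1.le hu.2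
  refine ((((H.hasDerivAt u hu).pow 3).const_sub 1).sqrt
    (one_sub_cube_pos (H.lt_one hu.1.le hu.2)).ne').congr_deriv ?_
  simp only [Pi.pow_apply]
  field_simp
  norm_num
  field_simp

theorem hasDerivAt_chordSum (H : IsArcLengthInverse F K) {c u : ℝ} (hc : c ≤ K)
    (hu : u ∈ Ioo 0 c) :
    HasDerivAt (fun u => chordSum (F u) (√(1 - F u ^ 3)) (F (c - u)) (√(1 - F (c - u) ^ 3)))
      0 u := by
  have hu₁ : u ∈ Ioo 0 K := ⟨hu.1, hu.2.trans_le hc⟩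
  have hu₂ : c - u ∈ Ioo 0 K := ⟨by linarith [hu.2], by linarith [hu.1]⟩
  have dx₁ := H.hasDerivAt u hu₁
  have dy₁ := H.hasDerivAt_ordinate hu₁
  have dx₂ := (H.hasDerivAt _ hu₂).comp_const_sub c u
  have dy₂ := (H.hasDerivAt_ordinate hu₂).comp_const_sub c u
  have h₁ := H.sq_ordinate (Ioo_subset_Icc_self hu₁)
  have h₂ := H.sq_ordinate (Ioo_subset_Icc_self hu₂)
  have hD := add_pos (H.ordinate_pos hu₁.1.le hu₁.2) (H.ordinate_pos hu₂.1.le hu₂.2)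
  refine (((((((dx₁.pow 2).add (dx₁.mul dx₂)).add (dx₂.pow 2)).div (dy₁.add dy₂)
    hD.ne').pow 2).add dx₁).add dx₂).congr_deriv ?_
  simp only [Pi.add_apply, Pi.mul_apply, Pi.pow_apply, Pi.div_apply]
  generalize F u = x₁ at *
  generalize F (c - u) = x₂ at *
  generalize √(1 - x₁ ^ 3) = y₁ at *
  generalize √(1 - x₂ ^ 3) = y₂ at *
  have hD' := hD.ne'
  norm_num
  field_simp
  linear_combination (3 * (x₁ ^ 2 + x₁ * x₂ + x₂ ^ 2) * (x₁ + x₂) + (y₁ + y₂) ^ 2) * (h₁ - h₂)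

/-- The addition theorem for the inverse of the integral of `1 / √(1 - t³)`. -/
theorem addition (H : IsArcLengthInverse F K) {u v : ℝ} (hu : 0 ≤ u) (hv : 0 ≤ v)
    (huv : u + v ≤ K) :
    chordSum (F u) (√(1 - F u ^ 3)) (F v) (√(1 - F v ^ 3)) ^ 2 * F (u + v) ^ 2 + 4 * F (u + v) -
      4 * chordSum (F u) (√(1 - F u ^ 3)) (F v) (√(1 - F v ^ 3)) = 0 := by
  set c := u + v with hc
  set φ : ℝ → ℝ := fun u =>
    chordSum (F u) (√(1 - F u ^ 3)) (F (c - u)) (√(1 - F (c - u) ^ 3)) with hφ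
  have hv' : v = c - u := by simp [hc]
  have hconst : φ u = φ 0 := by
    rcases hu.eq_or_lt with rfl | hu'
    · rfl
    by_cases hcu : u = K
    · have hv0 : v = 0 := by linarith
      have : c = K := by linarith
      simp only [hφ, this, hcu, sub_self, sub_zero, chordSum]
      ring
    have huK : u < K := lt_of_le_of_ne (by linarith) hcu
    have hcont : ContinuousOn φ (Icc 0 u) := by
      have c₁ : ContinuousOn F (Icc 0 u) := H.continuousOn.mono (Icc_subset_Icc_right huK.le)
      have c₂ : ContinuousOn (fun u => F (c - u)) (Icc 0 u) :=
        H.continuousOn.comp (by fun_prop) fun t ht => ⟨by linarith [ht.2], by linarith [ht.1]⟩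
      have hne : ∀ t ∈ Icc 0 u, √(1 - F t ^ 3) + √(1 - F (c - t) ^ 3) ≠ 0 := fun t ht =>
        (add_pos_of_pos_of_nonneg (H.ordinate_pos ht.1 (ht.2.trans_lt huK))
          (Real.sqrt_nonneg _)).ne'
      simp only [hφ, chordSum]
      have c₃ : ContinuousOn (fun t => √(1 - F t ^ 3)) (Icc 0 u) := by fun_prop
      have c₄ : ContinuousOn (fun t => √(1 - F (c - t) ^ 3)) (Icc 0 u) :=
        (continuousOn_const.sub (c₂.pow 3)).sqrt
      exact ((((((c₁.pow 2).add (c₁.mul c₂)).add (c₂.pow 2)).div (c₃.add c₄) hne).pow 2).add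
        c₁).add c₂
    obtain ⟨t, -, ht⟩ := exists_hasDerivAt_eq_slope φ (fun _ => 0) hu' hcont
      fun t ht => H.hasDerivAt_chordSum huv ⟨ht.1, by linarith [ht.2]⟩
    rw [eq_comm, div_eq_zero_iff] at ht
    rcases ht with ht | ht <;> linarith
  have hu0 : chordSum (F u) (√(1 - F u ^ 3)) (F v) (√(1 - F v ^ 3)) = φ 0 := by
    rw [← hconst, hv']
  have hcK : c ∈ Icc 0 K := ⟨by positivity, huv⟩
  have hy := H.sq_ordinate hcK
  have hy0 := Real.sqrt_nonneg (1 - F c ^ 3)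
  rw [hu0]
  simp only [hφ, chordSum, sub_zero, H.map_zero]
  generalize √(1 - F c ^ 3) = y at *
  generalize F c = x at *
  have hy1 : 1 + y ≠ 0 := by positivity
  have hj : ((0 ^ 2 + 0 * x + x ^ 2) / (√(1 - 0 ^ 3) + y)) ^ 2 + 0 + x = 2 * x / (1 + y) := by
    norm_num
    field_simp
    linear_combination x * hy
  rw [hj]
  field_simp
  linear_combination 4 * x * hy

/-- The abscissa of the first point dividing the arc into `l` equal parts is algebraic. -/
theorem isAlgebraic_map_div (H : IsArcLengthInverse F K) {l : ℕ} (hl : 1 ≤ l) :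
    IsAlgebraic ℤ (F (K / l)) := by
  have hl0 : (0 : ℝ) < l := by exact_mod_cast hl
  set v := K / l with hv
  have hlv : l * v = K := by rw [hv]; field_simp
  have hv0 : 0 < v := div_pos H.pos hl0
  have hmem {k : ℕ} (hk : k ≤ l) {u : ℝ} (h0 : 0 ≤ u) (h1 : u ≤ v) : k * u ∈ Icc 0 K := by
    have : (k : ℝ) ≤ l := by exact_mod_cast hk
    exact ⟨by positivity, hlv ▸ by gcongr⟩
  let U : Ultrafilter ℝ := Ultrafilter.of (𝓝[<] v)
  have hU : (U : Filter ℝ) ≤ 𝓝[<] v := Ultrafilter.of_le _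
  have hUv : ∀ᶠ u in (U : Filter ℝ), u ∈ Ioo 0 v := hU (Ioo_mem_nhdsLT hv0)
  let x (k : ℕ) : (U : Filter ℝ).Germ ℝ := ((fun u => F (k * u) : ℝ → ℝ) : (U : Filter ℝ).Germ ℝ)
  let y (k : ℕ) : (U : Filter ℝ).Germ ℝ :=
    ((fun u => √(1 - F (k * u) ^ 3) : ℝ → ℝ) : (U : Filter ℝ).Germ ℝ)
  let : Algebra ℤ[X] ((U : Filter ℝ).Germ ℝ) := (aeval (x 1)).toRingHom.toAlgebra
  have hx1 : IsAlgebraic ℤ[X] (x 1) := by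
    have : x 1 = algebraMap ℤ[X] ((U : Filter ℝ).Germ ℝ) X := (aeval_X (x 1)).symm
    rw [this]
    exact isAlgebraic_algebraMap _
  have hxl : IsAlgebraic ℤ[X] (x l) := by
    refine isAlgebraic_multiples (l := l) (y := y) ?_ hx1 ?_ ?_ l le_rfl
    · exact Germ.coe_eq.2 (Eventually.of_forall fun u => by simp [H.map_zero])
    · intro k hk
      refine Germ.coe_eq.2 ?_
      filter_upwards [hUv] with u hu
      exact H.sq_ordinate (hmem hk hu.1.le hu.2.le)
    · intro k hk
      refine Germ.coe_eq.2 ?_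
      filter_upwards [hUv] with u hu
      have := H.addition (hmem (by lia : k ≤ l) hu.1.le hu.2.le).1
        (hmem hl hu.1.le hu.2.le).1 (by
          have := (hmem hk hu.1.le hu.2.le).2
          push_cast at this ⊢
          linarith)
      rw [← add_mul] at this
      exact_mod_cast this
  obtain ⟨p, hp0, hp⟩ := hxl
  obtain ⟨q, hpq, hq⟩ := p.exists_eq_pow_rootMultiplicity_mul_and_not_dvd hp0 1
  have hxl1 : x l - 1 ≠ 0 := by
    intro h
    have h' := hUv.and (Germ.coe_eq.1 (sub_eq_zero.1 h))
    obtain ⟨u, hu, hu1⟩ := h'.exists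
    refine (H.lt_one (hmem le_rfl hu.1.le hu.2.le).1 ?_).ne hu1
    rw [← hlv]
    gcongr
    exact hu.2
  have hq0 : aeval (x l) q = 0 := by
    rw [hpq, map_mul, map_pow] at hp
    refine (mul_eq_zero.1 hp).resolve_left (pow_ne_zero _ ?_)
    simpa using hxl1
  have heval : (aeval (x l)).toRingHom = (Germ.coeRingHom (U : Filter ℝ)).comp
      (RingHom.pi fun u => (aevalAeval (R := ℤ) (F ((1 : ℕ) * u)) (F (l * u))).toRingHom) := by
    refine ringHom_ext' (ringHom_ext' (RingHom.ext_int _ _) ?_) ?_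
    · change aeval (x l) (C X) = Germ.ofFun fun u => aevalAeval (F ((1 : ℕ) * u)) (F (l * u)) (C X)
      simp only [aeval_C, aevalAeval_X]
      exact aeval_X _
    · change aeval (x l) X = Germ.ofFun fun u => aevalAeval (F ((1 : ℕ) * u)) (F (l * u)) X
      simp only [aeval_X, aevalAeval_Y]
      rfl
  have hev : (fun u => aevalAeval (F ((1 : ℕ) * u)) (F (l * u)) q) =ᶠ[U] fun _ => 0 :=
    Germ.coe_eq.1 ((RingHom.congr_fun heval q).symm.trans hq0)
  have hlim {k : ℕ} (hk : k ≤ l) : Tendsto (fun u => F (k * u)) U (𝓝 (F (k * v))) := by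
    refine (H.continuousOn _ (hmem hk hv0.le le_rfl)).tendsto.comp ?_
    refine tendsto_nhdsWithin_iff.2 ⟨?_, ?_⟩
    · exact ((continuous_const.mul continuous_id).tendsto v).mono_left
        (hU.trans nhdsWithin_le_nhds)
    · filter_upwards [hUv] with u hu using hmem hk hu.1.le hu.2.le
  have hq1 : aevalAeval (F ((1 : ℕ) * v)) (F (l * v)) q = 0 :=
    tendsto_nhds_unique ((((continuous_aevalAeval q).tendsto _).comp
      ((hlim hl).prodMk_nhds (hlim le_rfl))).congr' hev) tendsto_const_nhds
  rw [hlv, H.map_right, Nat.cast_one, one_mul] at hq1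
  refine ⟨q.eval 1, fun h => hq (dvd_iff_isRoot.2 h), ?_⟩
  rwa [← aevalAeval_one_right]

end IsArcLengthInverse

/-- If `1 ≤ l`, `i ≤ l` and `s ∈ [0,1]` satisfies
`∫₀ˢ dt/√(1-t³) = (i/l)·∫₀¹ dt/√(1-t³)`, then `s` is algebraic over `ℚ`.
(Hence the equal-length division points of the sinusoidal spiral `r^{3/2} = 2cos((3/2)θ)` starting
from the origin are algebraic.) -/
theorem stmt_9 (l i : ℕ) (hl : 1 ≤ l) (hi : i ≤ l) (s : ℝ) (hs : s ∈ Set.Icc (0:ℝ) 1)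
    (h : (∫ t in (0:ℝ)..s, 1 / Real.sqrt (1 - t ^ 3)) =
      ((i : ℝ) / (l : ℝ)) * ∫ t in (0:ℝ)..1, 1 / Real.sqrt (1 - t ^ 3)) :
    IsAlgebraic ℚ s := by
  obtain ⟨F, H, hF⟩ := exists_isArcLengthInverse
  rw [← hF s hs, h]
  generalize (∫ t in (0:ℝ)..1, 1 / Real.sqrt (1 - t ^ 3)) = K at *
  have hl0 : (0 : ℝ) < l := by exact_mod_cast hl
  have hmem {k : ℕ} (hk : k ≤ l) : (k : ℝ) / l * K ∈ Icc 0 K := by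
    have hk' : (k : ℝ) / l ≤ 1 := (div_le_one hl0).2 (by exact_mod_cast hk)
    exact ⟨mul_nonneg (by positivity) H.pos.le, mul_le_of_le_one_left H.pos.le hk'⟩
  refine IsAlgebraic.extendScalars (R := ℤ) Int.cast_injective ?_
  refine isAlgebraic_multiples (x := fun k : ℕ => F (k / l * K))
    (y := fun k : ℕ => √(1 - F (k / l * K) ^ 3)) ?_ ?_ ?_ ?_ i hi
  · simp [H.map_zero]
  · have h1 : ((1 : ℕ) : ℝ) / l * K = K / l := by
      push_cast
      ring
    simpa only [h1] using H.isAlgebraic_map_div hl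
  · exact fun k hk => H.sq_ordinate (hmem hk)
  · intro k hk
    have hsum : (k : ℝ) / l * K + (1 : ℕ) / l * K = (k + 1 : ℕ) / l * K := by
      push_cast
      ring
    have := H.addition (hmem (by lia : k ≤ l)).1 (hmem hl).1 (hsum ▸ (hmem hk).2)
    rwa [hsum] at this
end

section
/- Let a be a real algebraic number with 0 < a < 1, let n ≥ 1 and 0 ≤ i ≤ n be integers, and suppose v ∈ [√(1−a⁴), 1] satisfies ∫_{√(1−a⁴)}^{v} dx/√(x(1−x)(x² − (1−a⁴))) = (i/n)·∫_{√(1−a⁴)}^{1} dx/√(x(1−x)(x² − (1−a⁴))). Then v is algebraic over ℚ. Consequently, for every n ≥ 1 there are two algebraic points on the Cassini oval C_a = {z ∈ ℂ : |z² − a²| = 1} such that the length of the shortest arc joining them equals l(C_a)/(4n). -/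
/-- The real Jacobi elliptic functions of parameter `m`, characterised by their differential
equations, quadratic relations and initial values. -/
structure IsJacobiTriple (m : ℝ) (s c d : ℝ → ℝ) : Prop where
  hasDerivAt_sn (u : ℝ) : HasDerivAt s (c u * d u) u
  hasDerivAt_cn (u : ℝ) : HasDerivAt c (-(s u * d u)) u
  hasDerivAt_dn (u : ℝ) : HasDerivAt d (-(m * s u * c u)) u
  sq_add_sq (u : ℝ) : s u ^ 2 + c u ^ 2 = 1
  sq_add_mul_sq (u : ℝ) : d u ^ 2 + m * s u ^ 2 = 1
  sn_zero : s 0 = 0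
  cn_zero : c 0 = 1
  dn_zero : d 0 = 1

namespace IsJacobiTriple

variable {m : ℝ} {s c d : ℝ → ℝ}

lemma one_sub_pos (h : IsJacobiTriple m s c d) (hm0 : 0 ≤ m) (hm1 : m < 1) (u w : ℝ) :
    0 < 1 - m * s u ^ 2 * s w ^ 2 := by
  have h1 : s u ^ 2 ≤ 1 := by nlinarith [h.sq_add_sq u, sq_nonneg (c u)]
  have h2 : s w ^ 2 ≤ 1 := by nlinarith [h.sq_add_sq w, sq_nonneg (c w)]
  have h3 : s u ^ 2 * s w ^ 2 ≤ 1 := mul_le_one₀ h1 (sq_nonneg _) h2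
  nlinarith

lemma eq_of_hasDerivAt_zero {f : ℝ → ℝ} (hf : ∀ x, HasDerivAt f 0 x) (x y : ℝ) : f x = f y :=
  is_const_of_deriv_eq_zero (fun x => (hf x).differentiableAt) (fun x => (hf x).deriv) x y

lemma sn_add (h : IsJacobiTriple m s c d) (hm0 : 0 ≤ m) (hm1 : m < 1) (u w : ℝ) :
    s (u + w) * (1 - m * s u ^ 2 * s w ^ 2) = s u * c w * d w + s w * c u * d u := by
  have key : ∀ x, HasDerivAt (fun x => (s x * c (u + w - x) * d (u + w - x)
      + s (u + w - x) * c x * d x) / (1 - m * s x ^ 2 * s (u + w - x) ^ 2)) 0 x := by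
    intro x
    have hi : HasDerivAt (fun x : ℝ => u + w - x) (-1) x := (hasDerivAt_id x).const_sub (u + w)
    have s2 := (h.hasDerivAt_sn (u + w - x)).comp x hi
    have c2 := (h.hasDerivAt_cn (u + w - x)).comp x hi
    have d2 := (h.hasDerivAt_dn (u + w - x)).comp x hi
    have s1 := h.hasDerivAt_sn x
    have c1 := h.hasDerivAt_cn x
    have d1 := h.hasDerivAt_dn x
    have hne := (h.one_sub_pos hm0 hm1 x (u + w - x)).ne'
    have q1 := h.sq_add_sq x
    have q2 := h.sq_add_sq (u + w - x)
    have r1 := h.sq_add_mul_sq x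
    have r2 := h.sq_add_mul_sq (u + w - x)
    refine (((((s1.mul c2).mul d2).add ((s2.mul c1).mul d1)).div
      (((s1.pow 2).const_mul m |>.mul (s2.pow 2)).const_sub 1) hne)).congr_deriv ?_
    simp only [Function.comp, Pi.mul_apply, Pi.add_apply, Pi.pow_apply]
    rw [div_eq_zero_iff]
    left
    generalize s (u + w - x) = S at *
    generalize c (u + w - x) = C at *
    generalize d (u + w - x) = D at *
    generalize s x = p at *
    generalize c x = q at *
    generalize d x = r at *
    have e1 : q ^ 2 = 1 - p ^ 2 := by linarith
    have e2 : C ^ 2 = 1 - S ^ 2 := by linarith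
    have e3 : r ^ 2 = 1 - m * p ^ 2 := by linarith
    have e4 : D ^ 2 = 1 - m * S ^ 2 := by linarith
    grind
  have := eq_of_hasDerivAt_zero key u 0
  simp only [h.sn_zero, h.cn_zero, h.dn_zero, add_sub_cancel_left, sub_zero] at this
  rw [div_eq_iff (h.one_sub_pos hm0 hm1 u w).ne'] at this
  rw [this]
  simp

lemma cn_add (h : IsJacobiTriple m s c d) (hm0 : 0 ≤ m) (hm1 : m < 1) (u w : ℝ) :
    c (u + w) * (1 - m * s u ^ 2 * s w ^ 2) = c u * c w - s u * s w * d u * d w := by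
  have key : ∀ x, HasDerivAt (fun x => (c x * c (u + w - x)
      - s x * s (u + w - x) * d x * d (u + w - x)) / (1 - m * s x ^ 2 * s (u + w - x) ^ 2)) 0 x := by
    intro x
    have hi : HasDerivAt (fun x : ℝ => u + w - x) (-1) x := (hasDerivAt_id x).const_sub (u + w)
    have s2 := (h.hasDerivAt_sn (u + w - x)).comp x hi
    have c2 := (h.hasDerivAt_cn (u + w - x)).comp x hi
    have d2 := (h.hasDerivAt_dn (u + w - x)).comp x hi
    have s1 := h.hasDerivAt_sn x
    have c1 := h.hasDerivAt_cn x
    have d1 := h.hasDerivAt_dn x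
    have hne := (h.one_sub_pos hm0 hm1 x (u + w - x)).ne'
    have q1 := h.sq_add_sq x
    have q2 := h.sq_add_sq (u + w - x)
    have r1 := h.sq_add_mul_sq x
    have r2 := h.sq_add_mul_sq (u + w - x)
    refine (((c1.mul c2).sub (((s1.mul s2).mul d1).mul d2)).div
      (((s1.pow 2).const_mul m |>.mul (s2.pow 2)).const_sub 1) hne).congr_deriv ?_
    simp only [Function.comp, Pi.mul_apply, Pi.sub_apply, Pi.pow_apply]
    rw [div_eq_zero_iff]
    left
    generalize s (u + w - x) = S at *
    generalize c (u + w - x) = C at *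
    generalize d (u + w - x) = D at *
    generalize s x = p at *
    generalize c x = q at *
    generalize d x = r at *
    have e1 : q ^ 2 = 1 - p ^ 2 := by linarith
    have e2 : C ^ 2 = 1 - S ^ 2 := by linarith
    have e3 : r ^ 2 = 1 - m * p ^ 2 := by linarith
    have e4 : D ^ 2 = 1 - m * S ^ 2 := by linarith
    grind
  have := eq_of_hasDerivAt_zero key u 0
  simp only [h.sn_zero, h.cn_zero, h.dn_zero, add_sub_cancel_left, sub_zero] at this
  rw [div_eq_iff (h.one_sub_pos hm0 hm1 u w).ne'] at this
  rw [this]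
  simp

lemma dn_add (h : IsJacobiTriple m s c d) (hm0 : 0 ≤ m) (hm1 : m < 1) (u w : ℝ) :
    d (u + w) * (1 - m * s u ^ 2 * s w ^ 2) = d u * d w - m * s u * s w * c u * c w := by
  have key : ∀ x, HasDerivAt (fun x => (d x * d (u + w - x)
      - m * s x * s (u + w - x) * c x * c (u + w - x)) /
        (1 - m * s x ^ 2 * s (u + w - x) ^ 2)) 0 x := by
    intro x
    have hi : HasDerivAt (fun x : ℝ => u + w - x) (-1) x := (hasDerivAt_id x).const_sub (u + w)
    have s2 := (h.hasDerivAt_sn (u + w - x)).comp x hi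
    have c2 := (h.hasDerivAt_cn (u + w - x)).comp x hi
    have d2 := (h.hasDerivAt_dn (u + w - x)).comp x hi
    have s1 := h.hasDerivAt_sn x
    have c1 := h.hasDerivAt_cn x
    have d1 := h.hasDerivAt_dn x
    have hne := (h.one_sub_pos hm0 hm1 x (u + w - x)).ne'
    have q1 := h.sq_add_sq x
    have q2 := h.sq_add_sq (u + w - x)
    have r1 := h.sq_add_mul_sq x
    have r2 := h.sq_add_mul_sq (u + w - x)
    refine (((d1.mul d2).sub ((((s1.const_mul m).mul s2).mul c1).mul c2)).div
      (((s1.pow 2).const_mul m |>.mul (s2.pow 2)).const_sub 1) hne).congr_deriv ?_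
    simp only [Function.comp, Pi.mul_apply, Pi.sub_apply, Pi.pow_apply]
    rw [div_eq_zero_iff]
    left
    generalize s (u + w - x) = S at *
    generalize c (u + w - x) = C at *
    generalize d (u + w - x) = D at *
    generalize s x = p at *
    generalize c x = q at *
    generalize d x = r at *
    have e1 : q ^ 2 = 1 - p ^ 2 := by linarith
    have e2 : C ^ 2 = 1 - S ^ 2 := by linarith
    have e3 : r ^ 2 = 1 - m * p ^ 2 := by linarith
    have e4 : D ^ 2 = 1 - m * S ^ 2 := by linarith
    grind
  have := eq_of_hasDerivAt_zero key u 0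
  simp only [h.sn_zero, h.cn_zero, h.dn_zero, add_sub_cancel_left, sub_zero] at this
  rw [div_eq_iff (h.one_sub_pos hm0 hm1 u w).ne'] at this
  rw [this]
  simp

end IsJacobiTriple

namespace IsJacobiTriple

open Polynomial

variable {L : Type*} [Field L] [Algebra L ℝ] {μ : L} {s c d : ℝ → ℝ}

/-- Numerators and denominator, as polynomials in `sn² u`, of `sn, cn, dn` at an odd multiple. -/
structure OddMultiple (s c d : ℝ → ℝ) (u w : ℝ) (A B E T : L[X]) : Prop where
  den_ne : aeval (s u ^ 2) T ≠ 0
  sn_eq : s w * aeval (s u ^ 2) T = s u * aeval (s u ^ 2) A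
  cn_eq : c w * aeval (s u ^ 2) T = c u * aeval (s u ^ 2) B
  dn_eq : d w * aeval (s u ^ 2) T = d u * aeval (s u ^ 2) E
  cn_zero : B.eval 0 = 1
  dn_zero : E.eval 0 = 1
  den_zero : T.eval 0 = 1
  sn_one : A.eval 1 ^ 2 = T.eval 1 ^ 2
  dn_one : E.eval 1 ^ 2 = T.eval 1 ^ 2
  den_one : T.eval 1 ≠ 0

/-- Numerators and denominator, as polynomials in `sn² u`, of `sn, cn, dn` at an even multiple. -/
structure EvenMultiple (s c d : ℝ → ℝ) (u w : ℝ) (A B E T : L[X]) : Prop where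
  den_ne : aeval (s u ^ 2) T ≠ 0
  sn_eq : s w * aeval (s u ^ 2) T = s u * c u * d u * aeval (s u ^ 2) A
  cn_eq : c w * aeval (s u ^ 2) T = aeval (s u ^ 2) B
  dn_eq : d w * aeval (s u ^ 2) T = aeval (s u ^ 2) E
  cn_zero : B.eval 0 = 1
  dn_zero : E.eval 0 = 1
  den_zero : T.eval 0 = 1
  cn_one : B.eval 1 ^ 2 = T.eval 1 ^ 2
  dn_one : E.eval 1 ^ 2 = T.eval 1 ^ 2
  den_one : T.eval 1 ≠ 0

lemma OddMultiple.add_one (h : IsJacobiTriple (algebraMap L ℝ μ) s c d)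
    (hm0 : 0 ≤ algebraMap L ℝ μ) (hm1 : algebraMap L ℝ μ < 1) {u w : ℝ} {A B E T : L[X]}
    (hw : OddMultiple s c d u w A B E T) :
    EvenMultiple s c d u (w + u) (A * T + B * E)
      (B * T * (1 - X) - A * E * X * (1 - C μ * X))
      (E * T * (1 - C μ * X) - C μ * A * B * X * (1 - X))
      (T ^ 2 - C μ * A ^ 2 * X ^ 2) := by
  obtain ⟨hT, hA, hB, hE, b0, e0, t0, a1, e1, t1⟩ := hw
  have hpos := (h.one_sub_pos hm0 hm1 w u).ne'
  have hs := h.sn_add hm0 hm1 w u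
  have hc := h.cn_add hm0 hm1 w u
  have hd := h.dn_add hm0 hm1 w u
  have hμ : μ ≠ 1 := by rintro rfl; simp at hm1
  have q1 : 1 - s u ^ 2 = c u ^ 2 := by linarith [h.sq_add_sq u]
  have r1 : 1 - algebraMap L ℝ μ * s u ^ 2 = d u ^ 2 := by linarith [h.sq_add_mul_sq u]
  have hden : aeval (s u ^ 2) (T ^ 2 - C μ * A ^ 2 * X ^ 2) =
      aeval (s u ^ 2) T ^ 2 * (1 - algebraMap L ℝ μ * s w ^ 2 * s u ^ 2) := by
    simp only [map_sub, map_mul, map_pow, aeval_C, aeval_X]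
    linear_combination (algebraMap L ℝ μ * s u ^ 2) *
      (s w * aeval (s u ^ 2) T + s u * aeval (s u ^ 2) A) * hA
  constructor
  · rw [hden]; positivity
  · rw [hden, show ∀ x y z : ℝ, x * (y * z) = y * (x * z) by intros; ring, hs]
    simp only [map_add, map_mul]
    linear_combination c u * d u * aeval (s u ^ 2) T * hA + s u * d w * aeval (s u ^ 2) T * hB +
      s u * c u * aeval (s u ^ 2) B * hE
  · rw [hden, show ∀ x y z : ℝ, x * (y * z) = y * (x * z) by intros; ring, hc]
    simp only [map_sub, map_mul, aeval_C, aeval_X, map_one, q1, r1]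
    linear_combination aeval (s u ^ 2) T * c u * hB - s u * d u * d w * aeval (s u ^ 2) T * hA -
      s u ^ 2 * d u * aeval (s u ^ 2) A * hE
  · rw [hden, show ∀ x y z : ℝ, x * (y * z) = y * (x * z) by intros; ring, hd]
    simp only [map_sub, map_mul, aeval_C, aeval_X, map_one, q1, r1]
    linear_combination aeval (s u ^ 2) T * d u * hE - algebraMap L ℝ μ * s u * c u * c w * aeval (s u ^ 2) T * hA -
      algebraMap L ℝ μ * s u ^ 2 * c u * aeval (s u ^ 2) A * hB
  · simp [b0, t0]
  · simp [e0, t0]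
  · simp [t0]
  · simp only [eval_sub, eval_mul, eval_pow, eval_C, eval_X, eval_one]
    linear_combination E.eval 1 ^ 2 * (1 - μ) ^ 2 * a1 + T.eval 1 ^ 2 * (1 - μ) ^ 2 * e1
      + μ * (T.eval 1 ^ 2 * (1 - μ) + T.eval 1 ^ 2 - μ * A.eval 1 ^ 2) * a1
  · simp only [eval_sub, eval_mul, eval_pow, eval_C, eval_X, eval_one]
    linear_combination T.eval 1 ^ 2 * (1 - μ) ^ 2 * e1
      + μ * (T.eval 1 ^ 2 * (1 - μ) + T.eval 1 ^ 2 - μ * A.eval 1 ^ 2) * a1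
  · simp only [eval_sub, eval_mul, eval_pow, eval_C, eval_X, a1]
    have := sub_ne_zero.2 hμ.symm
    have h2 : T.eval 1 ^ 2 - μ * T.eval 1 ^ 2 * 1 ^ 2 = (1 - μ) * T.eval 1 ^ 2 := by ring
    rw [h2]
    exact mul_ne_zero this (pow_ne_zero 2 t1)

lemma EvenMultiple.add_one (h : IsJacobiTriple (algebraMap L ℝ μ) s c d)
    (hm0 : 0 ≤ algebraMap L ℝ μ) (hm1 : algebraMap L ℝ μ < 1) {u w : ℝ} {A B E T : L[X]}
    (hw : EvenMultiple s c d u w A B E T) :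
    OddMultiple s c d u (w + u) (A * T * (1 - X) * (1 - C μ * X) + B * E)
      (B * T - A * E * X * (1 - C μ * X))
      (E * T - C μ * A * B * X * (1 - X))
      (T ^ 2 - C μ * A ^ 2 * X ^ 2 * (1 - X) * (1 - C μ * X)) := by
  obtain ⟨hT, hA, hB, hE, b0, e0, t0, b1, e1, t1⟩ := hw
  have hpos := (h.one_sub_pos hm0 hm1 w u).ne'
  have hs := h.sn_add hm0 hm1 w u
  have hc := h.cn_add hm0 hm1 w u
  have hd := h.dn_add hm0 hm1 w u
  have q1 : 1 - s u ^ 2 = c u ^ 2 := by linarith [h.sq_add_sq u]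
  have r1 : 1 - algebraMap L ℝ μ * s u ^ 2 = d u ^ 2 := by linarith [h.sq_add_mul_sq u]
  have hden : aeval (s u ^ 2) (T ^ 2 - C μ * A ^ 2 * X ^ 2 * (1 - X) * (1 - C μ * X)) =
      aeval (s u ^ 2) T ^ 2 * (1 - algebraMap L ℝ μ * s w ^ 2 * s u ^ 2) := by
    simp only [map_sub, map_mul, map_pow, aeval_C, aeval_X, map_one, q1, r1]
    linear_combination (algebraMap L ℝ μ * s u ^ 2) *
      (s w * aeval (s u ^ 2) T + s u * c u * d u * aeval (s u ^ 2) A) * hA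
  constructor
  · rw [hden]; positivity
  · rw [hden, show ∀ x y z : ℝ, x * (y * z) = y * (x * z) by intros; ring, hs]
    simp only [map_add, map_sub, map_mul, aeval_C, aeval_X, map_one, q1, r1]
    linear_combination c u * d u * aeval (s u ^ 2) T * hA + s u * d w * aeval (s u ^ 2) T * hB + s u * aeval (s u ^ 2) B * hE
  · rw [hden, show ∀ x y z : ℝ, x * (y * z) = y * (x * z) by intros; ring, hc]
    simp only [map_sub, map_mul, aeval_C, aeval_X, map_one, r1]
    linear_combination aeval (s u ^ 2) T * c u * hB - s u * d u * d w * aeval (s u ^ 2) T * hA -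
      s u ^ 2 * c u * d u ^ 2 * aeval (s u ^ 2) A * hE
  · rw [hden, show ∀ x y z : ℝ, x * (y * z) = y * (x * z) by intros; ring, hd]
    simp only [map_sub, map_mul, aeval_C, aeval_X, map_one, q1]
    linear_combination aeval (s u ^ 2) T * d u * hE - algebraMap L ℝ μ * s u * c u * c w * aeval (s u ^ 2) T * hA -
      algebraMap L ℝ μ * s u ^ 2 * c u ^ 2 * d u * aeval (s u ^ 2) A * hB
  · simp [b0, t0]
  · simp [e0, t0]
  · simp [t0]
  · simp only [eval_sub, eval_add, eval_mul, eval_pow, eval_C, eval_X, eval_one]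
    linear_combination E.eval 1 ^ 2 * b1 + T.eval 1 ^ 2 * e1
  · simp only [eval_sub, eval_mul, eval_pow, eval_C, eval_X, eval_one]
    linear_combination T.eval 1 ^ 2 * e1
  · simpa using t1

lemma exists_oddMultiple (h : IsJacobiTriple (algebraMap L ℝ μ) s c d)
    (hm0 : 0 ≤ algebraMap L ℝ μ) (hm1 : algebraMap L ℝ μ < 1) (u : ℝ) (k : ℕ) :
    ∃ A B E T : L[X], OddMultiple s c d u ((2 * k + 1 : ℕ) * u) A B E T := by
  induction k with
  | zero => exact ⟨1, 1, 1, 1, by constructor <;> simp⟩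
  | succ k ih =>
    obtain ⟨A, B, E, T, hw⟩ := ih
    have := (hw.add_one h hm0 hm1).add_one h hm0 hm1
    rw [show ((2 * k + 1 : ℕ) : ℝ) * u + u + u = ((2 * (k + 1) + 1 : ℕ) : ℝ) * u by
      push_cast; ring] at this
    exact ⟨_, _, _, _, this⟩

lemma exists_evenMultiple (h : IsJacobiTriple (algebraMap L ℝ μ) s c d)
    (hm0 : 0 ≤ algebraMap L ℝ μ) (hm1 : algebraMap L ℝ μ < 1) (u : ℝ) (k : ℕ) :
    ∃ A B E T : L[X], EvenMultiple s c d u ((2 * k + 2 : ℕ) * u) A B E T := by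
  obtain ⟨A, B, E, T, hw⟩ := exists_oddMultiple h hm0 hm1 u k
  have := hw.add_one h hm0 hm1
  rw [show ((2 * k + 1 : ℕ) : ℝ) * u + u = ((2 * k + 2 : ℕ) : ℝ) * u by push_cast; ring] at this
  exact ⟨_, _, _, _, this⟩

lemma isAlgebraic_of_cn_eq_zero (h : IsJacobiTriple (algebraMap L ℝ μ) s c d)
    (hm0 : 0 ≤ algebraMap L ℝ μ) (hm1 : algebraMap L ℝ μ < 1) {u : ℝ} {n : ℕ} (hn : n ≠ 0)
    (hc : c (n * u) = 0) : IsAlgebraic L (s u ^ 2) := by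
  rcases Nat.even_or_odd' n with ⟨k, rfl | rfl⟩
  · obtain ⟨j, rfl⟩ := Nat.exists_eq_succ_of_ne_zero (show k ≠ 0 by omega)
    obtain ⟨A, B, E, T, hw⟩ := exists_evenMultiple h hm0 hm1 u j
    have hB := hw.cn_eq
    rw [show 2 * j + 2 = 2 * j.succ by omega, hc, zero_mul] at hB
    exact ⟨B, by rintro rfl; simpa using hw.cn_zero, hB.symm⟩
  · obtain ⟨A, B, E, T, hw⟩ := exists_oddMultiple h hm0 hm1 u k
    have hB := hw.cn_eq
    rw [hc, zero_mul, eq_comm, mul_eq_zero] at hB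
    rcases hB with hB | hB
    · have := h.sq_add_sq u
      rw [hB] at this
      rw [show s u ^ 2 = 1 by linarith]
      exact isAlgebraic_one
    · exact ⟨B, by rintro rfl; simpa using hw.cn_zero, hB⟩

lemma isAlgebraic_of_sn_eq_zero (h : IsJacobiTriple (algebraMap L ℝ μ) s c d)
    (hm0 : 0 ≤ algebraMap L ℝ μ) (hm1 : algebraMap L ℝ μ < 1) {u : ℝ} {n : ℕ} (hn : Odd n)
    (hs : s (n * u) = 0) : IsAlgebraic L (s u ^ 2) := by
  obtain ⟨k, rfl⟩ := hn
  obtain ⟨A, B, E, T, hw⟩ := exists_oddMultiple h hm0 hm1 u k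
  have hA := hw.sn_eq
  rw [hs, zero_mul, eq_comm, mul_eq_zero] at hA
  rcases hA with hA | hA
  · rw [hA, zero_pow two_ne_zero]
    exact isAlgebraic_zero
  · refine ⟨A, ?_, hA⟩
    rintro rfl
    have := hw.sn_one
    simp only [eval_zero] at this
    exact hw.den_one (by simpa using this.symm)

lemma zeros_at_multiples {m : ℝ} (h : IsJacobiTriple m s c d) (hm0 : 0 ≤ m) (hm1 : m < 1)
    {K : ℝ} (hK : c K = 0) (k : ℕ) :
    s ((2 * k : ℕ) * K) = 0 ∧ c ((2 * k + 1 : ℕ) * K) = 0 := by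
  have hc_add : ∀ w, s w = 0 → c (w + K) = 0 := fun w hw => by
    have := h.cn_add hm0 hm1 w K
    simpa [hw, hK] using this
  have hs_add : ∀ w, c w = 0 → s (w + K) = 0 := fun w hw => by
    have := h.sn_add hm0 hm1 w K
    rw [hw, hK] at this
    simpa [(h.one_sub_pos hm0 hm1 w K).ne'] using this
  have hodd : ∀ k : ℕ, ((2 * k + 1 : ℕ) : ℝ) * K = (2 * k : ℕ) * K + K := fun k => by
    push_cast; ring
  induction k with
  | zero => simp [h.sn_zero, hK]
  | succ k ih =>
    have h1 : s ((2 * (k + 1) : ℕ) * K) = 0 := by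
      rw [show ((2 * (k + 1) : ℕ) : ℝ) * K = (2 * k + 1 : ℕ) * K + K by push_cast; ring]
      exact hs_add _ ih.2
    exact ⟨h1, by rw [hodd]; exact hc_add _ h1⟩

lemma isAlgebraic_sn_sq (h : IsJacobiTriple (algebraMap L ℝ μ) s c d)
    (hm0 : 0 ≤ algebraMap L ℝ μ) (hm1 : algebraMap L ℝ μ < 1) {u K : ℝ} (hK : c K = 0)
    {i n : ℕ} (hin : Nat.Coprime i n) (hn : n ≠ 0) (hu : n * u = i * K) :
    IsAlgebraic L (s u ^ 2) := by
  rcases Nat.even_or_odd' i with ⟨k, rfl | rfl⟩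
  · refine isAlgebraic_of_sn_eq_zero h hm0 hm1 (n := n) ?_ ?_
    · exact (Nat.Coprime.coprime_mul_right hin).odd_of_left
    · rw [hu]
      exact (zeros_at_multiples h hm0 hm1 hK k).1
  · exact isAlgebraic_of_cn_eq_zero h hm0 hm1 hn (by
      rw [hu]; exact (zeros_at_multiples h hm0 hm1 hK k).2)

end IsJacobiTriple

open Real in
lemma one_sub_mul_sin_sq_pos {m : ℝ} (hm0 : 0 ≤ m) (hm1 : m < 1) (θ : ℝ) :
    0 < 1 - m * sin θ ^ 2 := by
  nlinarith [sin_sq_le_one θ]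

/-- Legendre's incomplete elliptic integral of the first kind. -/
noncomputable def ellipticF (m φ : ℝ) : ℝ := ∫ θ in (0 : ℝ)..φ, 1 / √(1 - m * Real.sin θ ^ 2)

lemma hasDerivAt_ellipticF {m : ℝ} (hm0 : 0 ≤ m) (hm1 : m < 1) (φ : ℝ) :
    HasDerivAt (ellipticF m) (1 / √(1 - m * Real.sin φ ^ 2)) φ := by
  have hc : Continuous fun θ : ℝ => 1 / √(1 - m * Real.sin θ ^ 2) := by
    refine continuous_const.div (by fun_prop) fun θ => ?_
    exact (Real.sqrt_pos.2 (one_sub_mul_sin_sq_pos hm0 hm1 θ)).ne'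
  exact intervalIntegral.integral_hasDerivAt_right (hc.intervalIntegrable _ _)
    (hc.stronglyMeasurableAtFilter _ _) hc.continuousAt

lemma one_le_one_div_sqrt {m : ℝ} (hm0 : 0 ≤ m) (hm1 : m < 1) (θ : ℝ) :
    1 ≤ 1 / √(1 - m * Real.sin θ ^ 2) := by
  rw [le_div_iff₀ (Real.sqrt_pos.2 (one_sub_mul_sin_sq_pos hm0 hm1 θ)), one_mul]
  exact Real.sqrt_le_one.2 (by nlinarith [sq_nonneg (Real.sin θ)])

lemma ellipticF_zero (m : ℝ) : ellipticF m 0 = 0 := by simp [ellipticF]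

lemma exists_isJacobiTriple {m : ℝ} (hm0 : 0 ≤ m) (hm1 : m < 1) :
    ∃ s c d : ℝ → ℝ, IsJacobiTriple m s c d ∧
      (∀ φ, s (ellipticF m φ) = Real.sin φ) ∧ ∀ φ, c (ellipticF m φ) = Real.cos φ := by
  have hF := hasDerivAt_ellipticF hm0 hm1
  have hpos := one_sub_mul_sin_sq_pos hm0 hm1
  have hmono : StrictMono (ellipticF m) := strictMono_of_hasDerivAt_pos hF
    fun θ => one_div_pos.2 (Real.sqrt_pos.2 (hpos θ))
  have hmono' : Monotone fun θ => ellipticF m θ - θ :=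
    monotone_of_hasDerivAt_nonneg (fun θ => (hF θ).sub (hasDerivAt_id θ))
      fun θ => sub_nonneg.2 (one_le_one_div_sqrt hm0 hm1 θ)
  have hcont : Continuous (ellipticF m) :=
    continuous_iff_continuousAt.2 fun θ => (hF θ).continuousAt
  have hsurj : Function.Surjective (ellipticF m) := by
    refine hcont.surjective ?_ ?_
    · refine Filter.tendsto_atTop_mono' _ ?_ Filter.tendsto_id
      filter_upwards [Filter.eventually_ge_atTop 0] with θ hθ
      have := hmono' hθ
      simp only [ellipticF_zero, id] at this ⊢
      linarith
    · refine Filter.tendsto_atBot_mono' _ ?_ Filter.tendsto_id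
      filter_upwards [Filter.eventually_le_atBot 0] with θ hθ
      have := hmono' hθ
      simp only [ellipticF_zero, id] at this ⊢
      linarith
  let e := hmono.orderIsoOfSurjective _ hsurj
  have he : ∀ φ, e.symm (ellipticF m φ) = φ := fun φ => e.symm_apply_apply φ
  have he' : ∀ u, ellipticF m (e.symm u) = u := fun u => e.apply_symm_apply u
  have ham : ∀ u, HasDerivAt e.symm (√(1 - m * Real.sin (e.symm u) ^ 2)) u := by
    intro u
    have := HasDerivAt.of_local_left_inverse (e.symm.continuous.continuousAt) (hF (e.symm u))
      (one_div_pos.2 (Real.sqrt_pos.2 (hpos _))).ne' (Filter.Eventually.of_forall he')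
    simpa using this
  have h0 : e.symm 0 = 0 := by simpa [ellipticF_zero] using he 0
  refine ⟨fun u => Real.sin (e.symm u), fun u => Real.cos (e.symm u),
    fun u => √(1 - m * Real.sin (e.symm u) ^ 2), ⟨fun u => (ham u).sin, fun u => ?_, fun u => ?_,
    fun u => Real.sin_sq_add_cos_sq _, fun u => ?_, ?_, ?_, ?_⟩, fun φ => ?_, fun φ => ?_⟩
  · exact (ham u).cos.congr_deriv (by ring)
  · have hne := (Real.sqrt_pos.2 (hpos (e.symm u))).ne'
    refine ((((ham u).sin.pow 2).const_mul m).const_sub 1 |>.sqrt (hpos _).ne').congr_deriv ?_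
    simp only [Pi.pow_apply]
    field_simp
    push_cast
    ring
  · rw [Real.sq_sqrt (hpos _).le]; ring
  · simp [h0]
  · simp [h0]
  · simp [h0]
  · simp only [he]
  · simp only [he]

/-- The substitution `x = q / (1 - (1 - q) sin² θ)` brings the elliptic integral with branch points
`-q, 0, q, 1` into Legendre form. -/
lemma integral_eq_ellipticF {q φ : ℝ} (hq0 : 0 < q) (hq1 : q < 1) (hφ0 : 0 ≤ φ)
    (hφ1 : φ ≤ Real.pi / 2) :
    (∫ x in q..(q / (1 - (1 - q) * Real.sin φ ^ 2)), 1 / √(x * (1 - x) * (x ^ 2 - q ^ 2))) =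
      √(2 / q) * ellipticF ((1 - q) / 2) φ := by
  let f : ℝ → ℝ := fun θ => q / (1 - (1 - q) * Real.sin θ ^ 2)
  let f' : ℝ → ℝ := fun θ =>
    2 * q * (1 - q) * Real.sin θ * Real.cos θ / (1 - (1 - q) * Real.sin θ ^ 2) ^ 2
  have hW : ∀ θ, 0 < 1 - (1 - q) * Real.sin θ ^ 2 :=
    one_sub_mul_sin_sq_pos (sub_nonneg.2 hq1.le) (by linarith)
  have hf : ∀ θ, HasDerivAt f (f' θ) θ := by
    intro θ
    refine ((hasDerivAt_const θ q).div
      ((((Real.hasDerivAt_sin θ).pow 2).const_mul (1 - q)).const_sub 1) (hW θ).ne').congr_deriv ?_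
    simp only [f', Pi.pow_apply]
    congr 1
    push_cast
    ring
  have hmono : StrictMonoOn f (Set.Icc 0 φ) := by
    intro x hx y hy hxy
    have hs : Real.sin x < Real.sin y :=
      Real.sin_lt_sin_of_lt_of_le_pi_div_two (by linarith [hx.1, Real.pi_pos]) (hy.2.trans hφ1) hxy
    have hs0 : 0 ≤ Real.sin x :=
      Real.sin_nonneg_of_nonneg_of_le_pi hx.1 (by linarith [hx.2, Real.pi_pos])
    refine div_lt_div_of_pos_left hq0 (hW y) ?_
    have : Real.sin x ^ 2 < Real.sin y ^ 2 := by nlinarith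
    nlinarith
  have hcont : ContinuousOn f (Set.Icc 0 φ) := fun θ _ => (hf θ).continuousAt.continuousWithinAt
  have himg : f '' Set.Icc 0 φ = Set.Icc q (f φ) := by
    have hq : f 0 = q := by simp [f]
    refine Set.Subset.antisymm ?_ ?_
    · rintro _ ⟨θ, hθ, rfl⟩
      rw [← hq]
      exact ⟨hmono.monotoneOn ⟨le_rfl, hφ0⟩ hθ hθ.1, hmono.monotoneOn hθ ⟨hφ0, le_rfl⟩ hθ.2⟩
    · rw [← hq]
      exact intermediate_value_Icc hφ0 hcont
  have hle : q ≤ f φ := by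
    have : f φ ∈ f '' Set.Icc 0 φ := ⟨φ, ⟨hφ0, le_rfl⟩, rfl⟩
    rw [himg] at this
    exact this.1
  rw [intervalIntegral.integral_of_le hle, ellipticF, intervalIntegral.integral_of_le hφ0,
    ← MeasureTheory.integral_Icc_eq_integral_Ioc, ← himg,
    MeasureTheory.integral_image_eq_integral_abs_deriv_smul measurableSet_Icc
      (fun θ _ => (hf θ).hasDerivWithinAt) hmono.injOn,
    MeasureTheory.integral_Icc_eq_integral_Ioo, MeasureTheory.integral_Ioc_eq_integral_Ioo,
    ← MeasureTheory.integral_const_mul]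
  refine MeasureTheory.setIntegral_congr_fun measurableSet_Ioo fun θ hθ => ?_
  have hs : 0 < Real.sin θ :=
    Real.sin_pos_of_pos_of_lt_pi hθ.1 (by linarith [hθ.2, Real.pi_pos])
  have hc : 0 < Real.cos θ :=
    Real.cos_pos_of_mem_Ioo ⟨by linarith [hθ.1, Real.pi_pos], by linarith [hθ.2]⟩
  have hD : 0 < 1 - (1 - q) / 2 * Real.sin θ ^ 2 :=
    one_sub_mul_sin_sq_pos (by linarith) (by linarith) θ
  have h1q : 0 < 1 - q := by linarith
  have hWθ := hW θ
  have hf'0 : 0 < f' θ := by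
    have : 0 < 2 * q * (1 - q) * Real.sin θ * Real.cos θ := by positivity
    exact div_pos this (pow_pos hWθ 2)
  simp only [smul_eq_mul, abs_of_pos hf'0]
  have hprod : f θ * (1 - f θ) * (f θ ^ 2 - q ^ 2) =
      (f' θ) ^ 2 * (q / 2 * (1 - (1 - q) / 2 * Real.sin θ ^ 2)) := by
    have hcos := Real.cos_sq' θ
    simp only [f, f']
    generalize Real.cos θ = C at *
    generalize Real.sin θ = S at *
    have hne := hWθ.ne'
    field_simp
    rw [hcos]
    ring
  rw [hprod, Real.sqrt_mul (sq_nonneg _), Real.sqrt_sq hf'0.le, Real.sqrt_mul (by positivity),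
    show (2 : ℝ) / q = (q / 2)⁻¹ by field_simp, Real.sqrt_inv]
  have h2 : 0 < √(q / 2) := Real.sqrt_pos.2 (by positivity)
  have h3 := Real.sqrt_pos.2 hD
  field_simp

theorem stmt_10 (a : ℝ) (haAlg : IsAlgebraic ℚ a) (ha0 : 0 < a) (ha1 : a < 1)
    (n : ℕ) (hn : 1 ≤ n) (i : ℕ) (hi : i ≤ n)
    (v : ℝ) (hv : v ∈ Set.Icc (Real.sqrt (1 - a ^ 4)) 1)
    (h : (∫ x in Real.sqrt (1 - a ^ 4)..v,
            1 / Real.sqrt (x * (1 - x) * (x ^ 2 - (1 - a ^ 4)))) =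
      ((i : ℝ) / (n : ℝ)) *
        ∫ x in Real.sqrt (1 - a ^ 4)..1,
          1 / Real.sqrt (x * (1 - x) * (x ^ 2 - (1 - a ^ 4)))) :
    IsAlgebraic ℚ v := by
  have ha4 : a ^ 4 < 1 := pow_lt_one₀ ha0.le ha1 (by norm_num)
  have ha4' : 0 < a ^ 4 := by positivity
  obtain ⟨q, hq⟩ : ∃ q, q = √(1 - a ^ 4) := ⟨_, rfl⟩
  have hqsq : 1 - a ^ 4 = q ^ 2 := by rw [hq, Real.sq_sqrt (by linarith)]
  rw [← hq, hqsq] at h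
  rw [← hq] at hv
  have hq0 : 0 < q := by rw [hq]; exact Real.sqrt_pos.2 (by linarith)
  have hq1 : q < 1 := by nlinarith
  have hqalg : IsAlgebraic ℚ q := by
    refine IsAlgebraic.of_pow two_pos ?_
    rw [← hqsq]
    exact isAlgebraic_one.sub (haAlg.pow 4)
  have hW : ∀ θ, 0 < 1 - (1 - q) * Real.sin θ ^ 2 :=
    one_sub_mul_sin_sq_pos (by linarith) (by linarith)
  obtain ⟨φ, hφ, hφv⟩ : v ∈ (fun θ => q / (1 - (1 - q) * Real.sin θ ^ 2)) ''
      Set.Icc 0 (Real.pi / 2) := by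
    refine intermediate_value_Icc (by positivity) ?_ ?_
    · exact (continuous_const.div (by fun_prop) fun θ => (hW θ).ne').continuousOn
    · simpa [hq0.ne'] using hv
  dsimp only at hφv
  have hv_eq := integral_eq_ellipticF hq0 hq1 hφ.1 hφ.2
  have h1_eq := integral_eq_ellipticF hq0 hq1 (φ := Real.pi / 2) (by positivity) le_rfl
  rw [hφv] at hv_eq
  rw [Real.sin_pi_div_two, show q / (1 - (1 - q) * 1 ^ 2) = 1 by
    rw [one_pow, mul_one, sub_sub_cancel, div_self hq0.ne']] at h1_eq
  rw [hv_eq, h1_eq, mul_left_comm] at h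
  have h2q : √(2 / q) ≠ 0 := (Real.sqrt_pos.2 (by positivity)).ne'
  replace h := mul_left_cancel₀ h2q h
  have hm0 : 0 ≤ (1 - q) / 2 := by linarith
  have hm1 : (1 - q) / 2 < 1 := by linarith
  obtain ⟨s, c, d, hJ, hs, hc⟩ := exists_isJacobiTriple hm0 hm1
  have hmalg : IsAlgebraic ℚ ((1 - q) / 2) := by
    simpa [div_eq_mul_inv] using
      (isAlgebraic_one.sub hqalg).mul (isAlgebraic_algebraMap (A := ℝ) (1 / 2 : ℚ))
  let μ : algebraicClosure ℚ ℝ := ⟨(1 - q) / 2, mem_algebraicClosure_iff.2 hmalg⟩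
  have hK : c (ellipticF ((1 - q) / 2) (Real.pi / 2)) = 0 := by rw [hc, Real.cos_pi_div_two]
  have hg : 0 < Nat.gcd i n := Nat.gcd_pos_of_pos_right i hn
  have hnn : n / Nat.gcd i n ≠ 0 := (Nat.div_pos (Nat.gcd_le_right _ hn) hg).ne'
  have hrat : (i : ℝ) / n = (i / Nat.gcd i n : ℕ) / (n / Nat.gcd i n : ℕ) := by
    rw [Nat.cast_div (Nat.gcd_dvd_left i n) (by positivity),
      Nat.cast_div (Nat.gcd_dvd_right i n) (by positivity)]
    field_simp
  have halg : IsAlgebraic (algebraicClosure ℚ ℝ) (Real.sin φ ^ 2) := by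
    rw [← hs φ]
    refine IsJacobiTriple.isAlgebraic_sn_sq (μ := μ) hJ hm0 hm1 hK
      (Nat.coprime_div_gcd_div_gcd hg) hnn ?_
    rw [h, hrat]
    field_simp
  have : Algebra.IsAlgebraic ℚ (algebraicClosure ℚ ℝ) := algebraicClosure.isAlgebraic ℚ ℝ
  have halg' : IsAlgebraic ℚ (Real.sin φ ^ 2) := halg.restrictScalars ℚ
  rw [← hφv]
  exact hqalg.mul (isAlgebraic_one.sub ((isAlgebraic_one.sub hqalg).mul halg')).inv
end

section
/- For every real number a with 0 < a < 1, one has 2√2·(1−a⁴)^{1/4}·∫_{√(1−a⁴)}^{1} dv/√(v(1−v)(v² − (1−a⁴))) = 4·K((1 − √(1−a⁴))/2), where K(m) = ∫₀¹ dt/√((1−t²)(1−m t²)). In other words, the total length of the Cassini oval C_a = {z ∈ ℂ : |z² − a²| = 1} equals 4·K((1 − √(1−a⁴))/2). -/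
open Set MeasureTheory

section CassiniSubstitution

variable {s t : ℝ}

lemma cassini_denom_pos (hs : 0 < s) (ht : t ∈ Ioo (0 : ℝ) 1) :
    0 < 1 - (1 - s) * t ^ 2 := by
  have h : t ^ 2 < 1 := by nlinarith [ht.1, ht.2]
  nlinarith [sq_nonneg t]

lemma hasDerivAt_cassini_subst (hD : 1 - (1 - s) * t ^ 2 ≠ 0) :
    HasDerivAt (fun t : ℝ => s / (1 - (1 - s) * t ^ 2))
      (2 * s * (1 - s) * t / (1 - (1 - s) * t ^ 2) ^ 2) t := by
  have h := (((hasDerivAt_pow 2 t).const_mul (1 - s)).const_sub 1).fun_inv hD |>.const_mul s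
  refine h.congr_deriv ?_
  push_cast
  ring

lemma injOn_cassini_subst (hs : 0 < s) (hs1 : s < 1) :
    InjOn (fun t : ℝ => s / (1 - (1 - s) * t ^ 2)) (Ioo 0 1) := by
  intro x hx y hy hxy
  have hDx := (cassini_denom_pos hs hx).ne'
  have hDy := (cassini_denom_pos hs hy).ne'
  have h : s * (1 - (1 - s) * y ^ 2) = s * (1 - (1 - s) * x ^ 2) :=
    (div_eq_div_iff hDx hDy).1 hxy
  have h1 : s * (1 - s) * (x ^ 2 - y ^ 2) = 0 := by linear_combination h
  have h2 : x ^ 2 = y ^ 2 := by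
    have h3 : s * (1 - s) ≠ 0 := (mul_pos hs (sub_pos.2 hs1)).ne'
    exact sub_eq_zero.1 ((mul_eq_zero.1 h1).resolve_left h3)
  exact (pow_left_inj₀ hx.1.le hy.1.le two_ne_zero).1 h2

lemma image_cassini_subst (hs : 0 < s) (hs1 : s < 1) :
    (fun t : ℝ => s / (1 - (1 - s) * t ^ 2)) '' Ioo 0 1 = Ioo s 1 := by
  have h1s : 0 < 1 - s := sub_pos.2 hs1
  ext v
  constructor
  · rintro ⟨t, ht, rfl⟩
    have hD := cassini_denom_pos hs ht
    have h0 : 0 < t ^ 2 := pow_pos ht.1 2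
    have h1 : t ^ 2 < 1 := by nlinarith [ht.1, ht.2]
    refine ⟨?_, ?_⟩
    · rw [lt_div_iff₀ hD]
      nlinarith [mul_pos (mul_pos hs h1s) h0]
    · rw [div_lt_one hD]
      nlinarith
  · rintro ⟨hv, hv1⟩
    have hv0 : 0 < v := hs.trans hv
    have hq : 0 < (v - s) / ((1 - s) * v) := div_pos (sub_pos.2 hv) (mul_pos h1s hv0)
    refine ⟨Real.sqrt ((v - s) / ((1 - s) * v)), ⟨Real.sqrt_pos.2 hq, ?_⟩, ?_⟩
    · rw [Real.sqrt_lt' one_pos, one_pow, div_lt_one (mul_pos h1s hv0)]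
      nlinarith
    · have h : 1 - (1 - s) * ((v - s) / ((1 - s) * v)) = s / v := by
        field_simp
        ring
      simp only [Real.sq_sqrt hq.le, h]
      field_simp

lemma cassini_integrand_subst (hs : 0 < s) (hs1 : s < 1) (ht : t ∈ Ioo (0 : ℝ) 1) :
    |2 * s * (1 - s) * t / (1 - (1 - s) * t ^ 2) ^ 2| •
      (1 / Real.sqrt (s / (1 - (1 - s) * t ^ 2) * (1 - s / (1 - (1 - s) * t ^ 2)) *
        ((s / (1 - (1 - s) * t ^ 2)) ^ 2 - s ^ 2))) =
      2 / Real.sqrt (2 * s) * (1 / Real.sqrt ((1 - t ^ 2) * (1 - (1 - s) / 2 * t ^ 2))) := by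
  have hD := cassini_denom_pos hs ht
  have h1s : 0 < 1 - s := sub_pos.2 hs1
  have ht0 := ht.1
  have h1 : t ^ 2 < 1 := by nlinarith [ht.1, ht.2]
  have hR : 0 < (1 - t ^ 2) * (1 - (1 - s) / 2 * t ^ 2) := by
    apply mul_pos <;> nlinarith
  have hrad : s / (1 - (1 - s) * t ^ 2) * (1 - s / (1 - (1 - s) * t ^ 2)) *
      ((s / (1 - (1 - s) * t ^ 2)) ^ 2 - s ^ 2) =
      (s * (1 - s) * t / (1 - (1 - s) * t ^ 2) ^ 2) ^ 2 *
        (2 * s * ((1 - t ^ 2) * (1 - (1 - s) / 2 * t ^ 2))) := by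
    field_simp
    ring
  have hc : 0 < s * (1 - s) * t / (1 - (1 - s) * t ^ 2) ^ 2 := by positivity
  have hsR := Real.sqrt_pos.2 hR
  have hs2 : 0 < Real.sqrt (2 * s) := Real.sqrt_pos.2 (by positivity)
  have habs : |2 * s * (1 - s) * t / (1 - (1 - s) * t ^ 2) ^ 2| =
      2 * (s * (1 - s) * t / (1 - (1 - s) * t ^ 2) ^ 2) := by
    rw [abs_of_pos (by positivity)]
    ring
  rw [hrad, Real.sqrt_mul (sq_nonneg _), Real.sqrt_sq hc.le,
    Real.sqrt_mul (by positivity : 0 ≤ 2 * s), habs, smul_eq_mul]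
  generalize s * (1 - s) * t / (1 - (1 - s) * t ^ 2) ^ 2 = c at hc
  field_simp

theorem integral_cassini_eq_ellipticK (hs : 0 < s) (hs1 : s < 1) :
    ∫ v in s..1, 1 / Real.sqrt (v * (1 - v) * (v ^ 2 - s ^ 2)) =
      2 / Real.sqrt (2 * s) *
        ∫ t in (0 : ℝ)..1, 1 / Real.sqrt ((1 - t ^ 2) * (1 - (1 - s) / 2 * t ^ 2)) := by
  rw [intervalIntegral.integral_of_le hs1.le, intervalIntegral.integral_of_le zero_le_one,
    integral_Ioc_eq_integral_Ioo, integral_Ioc_eq_integral_Ioo, ← image_cassini_subst hs hs1,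
    integral_image_eq_integral_abs_deriv_smul measurableSet_Ioo
      (fun t ht => (hasDerivAt_cassini_subst
        (cassini_denom_pos hs ht).ne').hasDerivWithinAt)
      (injOn_cassini_subst hs hs1),
    ← integral_const_mul]
  exact setIntegral_congr_fun measurableSet_Ioo
    fun t ht => cassini_integrand_subst hs hs1 ht

end CassiniSubstitution

/-- For `0 < a < 1`, the total length of the Cassini oval `{z : |z²-a²| = 1}`, namely
`2√2·(1-a⁴)^{1/4}·∫_{√(1-a⁴)}^{1} dv/√(v(1-v)(v²-(1-a⁴)))`, equals
`4·K((1-√(1-a⁴))/2)` with `K(m) = ∫₀¹ dt/√((1-t²)(1-mt²))`. -/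
theorem stmt_11 (a : ℝ) (ha0 : 0 < a) (ha1 : a < 1) :
    2 * Real.sqrt 2 * (1 - a ^ 4) ^ ((1 : ℝ) / 4) *
        (∫ v in Real.sqrt (1 - a ^ 4)..1,
          1 / Real.sqrt (v * (1 - v) * (v ^ 2 - (1 - a ^ 4)))) =
      4 * ∫ t in (0:ℝ)..1,
        1 / Real.sqrt ((1 - t ^ 2) * (1 - ((1 - Real.sqrt (1 - a ^ 4)) / 2) * t ^ 2)) := by
  have h4 : a ^ 4 < 1 := pow_lt_one₀ ha0.le ha1 four_ne_zero
  have hb : 0 < 1 - a ^ 4 := sub_pos.2 h4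
  have hs : 0 < Real.sqrt (1 - a ^ 4) := Real.sqrt_pos.2 hb
  have hs1 : Real.sqrt (1 - a ^ 4) < 1 := by
    rw [Real.sqrt_lt' one_pos]
    linarith [pow_pos ha0 4]
  have hroot : (1 - a ^ 4) ^ ((1 : ℝ) / 4) = Real.sqrt (Real.sqrt (1 - a ^ 4)) := by
    rw [Real.sqrt_eq_rpow, Real.sqrt_eq_rpow, ← Real.rpow_mul hb.le]
    norm_num
  have h := integral_cassini_eq_ellipticK hs hs1
  rw [Real.sq_sqrt hb.le] at h
  have hss := Real.sqrt_pos.2 hs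
  rw [h, hroot, Real.sqrt_mul zero_le_two]
  generalize (∫ t in (0:ℝ)..1, 1 / Real.sqrt ((1 - t ^ 2) *
    (1 - ((1 - Real.sqrt (1 - a ^ 4)) / 2) * t ^ 2))) = K
  field_simp
  ring
end
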